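/- arXiv:2310.13750 — 3 statements merged into one kernel-verified Lean document; each statement's English description precedes it below -/
import Mathlib

section
/- Let γ > 0, 1 ≤ r ≤ ∞ and 0 < q < ∞, and assume γ ≥ max{3/(2q) − 1/(2r′), 2/q − 1/r′} and γ > 2/q − 1/2. Then there is C > 0 such that for every measurable F : ℝ → ℂ one has sup_{t>0} t·|{(x,y) ∈ ℝ² : |R*_γF(x,y)| > t}|^{1/q} ≤ C · ‖F‖_{L^r(S¹)}. -/
open MeasureTheory Real Set Filter
open scoped ENNReal

noncomputable section

/-- Fourier extension operator of the unit circle,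
`(R*F)(x,y) = (1/(2π)) ∫_0^{2π} F(φ) exp(i(x cos φ + y sin φ)) dφ`. -/
def Rext (F : ℝ → ℂ) (x y : ℝ) : ℂ :=
  Complex.ofReal (1 / (2 * π)) *
    ∫ φ in (0:ℝ)..(2 * π),
      F φ * Complex.exp (Complex.I * Complex.ofReal (x * Real.cos φ + y * Real.sin φ))

/-- Weighted extension operator with product weight `(1+|x|)^{-α}(1+|y|)^{-β}`. -/
def Rab (α β : ℝ) (F : ℝ → ℂ) (x y : ℝ) : ℂ :=
  Rext F x y * Complex.ofReal ((1 + |x|) ^ (-α) * (1 + |y|) ^ (-β))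

/-- Weighted extension operator with weight `(1+|x|+|y|)^{-γ}`. -/
def Rgamma (γ : ℝ) (F : ℝ → ℂ) (x y : ℝ) : ℂ :=
  Rext F x y * Complex.ofReal ((1 + |x| + |y|) ^ (-γ))

/-- `L^r` norm on the circle, parametrized by `[0, 2π]`. -/
def circleLp (r : ℝ≥0∞) (F : ℝ → ℂ) : ℝ≥0∞ :=
  eLpNorm F r (volume.restrict (Ioc (0:ℝ) (2 * π)))

/-- `L^q` quasinorm on the plane. -/
def planeLp (q : ℝ≥0∞) (g : ℝ × ℝ → ℂ) : ℝ≥0∞ :=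
  eLpNorm g q (volume : Measure (ℝ × ℝ))

/-- Weak `L^q` quasinorm on the line. -/
def wline (q : ℝ) (g : ℝ → ℂ) : ℝ≥0∞ :=
  ⨆ (t : ℝ) (_ : 0 < t), ENNReal.ofReal t * (volume {x : ℝ | t < ‖g x‖}) ^ (1 / q)

/-- Weak `L^q` quasinorm on the line, for `ℝ≥0∞`-valued functions. -/
def wlineE (q : ℝ) (g : ℝ → ℝ≥0∞) : ℝ≥0∞ :=
  ⨆ (t : ℝ) (_ : 0 < t), ENNReal.ofReal t * (volume {x : ℝ | ENNReal.ofReal t < g x}) ^ (1 / q)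

/-- Mixed weak quasinorm `L^{q,∞}_x(L^{q,∞}_y)`. -/
def mixedXY (q : ℝ) (g : ℝ × ℝ → ℂ) : ℝ≥0∞ :=
  wlineE q fun x => wline q fun y => g (x, y)

/-- Mixed weak quasinorm `L^{q,∞}_y(L^{q,∞}_x)`. -/
def mixedYX (q : ℝ) (g : ℝ × ℝ → ℂ) : ℝ≥0∞ :=
  wlineE q fun y => wline q fun x => g (x, y)

/-- Weak `L^q` quasinorm on the plane. -/
def wplane (q : ℝ) (g : ℝ × ℝ → ℂ) : ℝ≥0∞ :=
  ⨆ (t : ℝ) (_ : 0 < t), ENNReal.ofReal t * (volume {p : ℝ × ℝ | t < ‖g p‖}) ^ (1 / q)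

/-- Lorentz `L^{r,1}` norm on the circle. -/
def lorentz1 (r : ℝ) (F : ℝ → ℂ) : ℝ≥0∞ :=
  ∫⁻ t in Ioi (0:ℝ), (volume {φ ∈ Icc (0:ℝ) (2 * π) | t < ‖F φ‖}) ^ (1 / r)

/-- Weak `L^r` quasinorm on the circle. -/
def wcircle (r : ℝ) (F : ℝ → ℂ) : ℝ≥0∞ :=
  ⨆ (t : ℝ) (_ : 0 < t), ENNReal.ofReal t * (volume {φ ∈ Icc (0:ℝ) (2 * π) | t < ‖F φ‖}) ^ (1 / r)


/-- phase -/
def ph (x y a b : ℝ) : ℂ := Complex.exp (Complex.I * Complex.ofReal (x * a + y * b))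

lemma norm_ph (x y a b : ℝ) : ‖ph x y a b‖ = 1 := by
  unfold ph
  rw [mul_comm, Complex.norm_exp_ofReal_mul_I]

lemma continuous_ph : Continuous (fun z : ℝ × ℝ × ℝ × ℝ => ph z.1 z.2.1 z.2.2.1 z.2.2.2) := by
  unfold ph
  fun_prop

lemma ph_mul_conj (x y a b a' b' : ℝ) :
    ph x y a b * (starRingEnd ℂ) (ph x y a' b') = ph x y (a - a') (b - b') := by
  unfold ph
  rw [← Complex.exp_conj, ← Complex.exp_add]
  congr 1
  simp
  ring

/-- gaussian weight -/
def gw (R : ℝ) (p : ℝ × ℝ) : ℝ := Real.exp (-(p.1 ^ 2 + p.2 ^ 2) / R ^ 2)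

lemma gw_pos (R : ℝ) (p : ℝ × ℝ) : 0 < gw R p := Real.exp_pos _

lemma continuous_gw (R : ℝ) : Continuous (gw R) := by
  unfold gw; fun_prop

lemma gauss1 (R : ℝ) (hR : 0 < R) (v : ℝ) :
    ∫ x : ℝ, Complex.exp (Complex.I * v * x) * Complex.exp (-((1 / R ^ 2 : ℝ) : ℂ) * x ^ 2)
      = ((Real.sqrt (π * R ^ 2) * Real.exp (-R ^ 2 * v ^ 2 / 4) : ℝ) : ℂ) := by
  rw [fourierIntegral_gaussian]
  · rw [← Complex.ofReal_div, Real.sqrt_eq_rpow]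
    push_cast
    rw [Complex.ofReal_cpow (by positivity)]
    congr 1
    · push_cast
      field_simp
    · congr 1
      have : (R:ℂ) ≠ 0 := by exact_mod_cast hR.ne'
      field_simp
  · rw [Complex.ofReal_re]; positivity

lemma gw_int (R : ℝ) (hR : 0 < R) : Integrable (gw R) := by
  have h := integrable_exp_neg_mul_sq (b := 1 / R ^ 2) (by positivity)
  have := h.mul_prod h
  refine this.congr (Eventually.of_forall fun p => ?_)
  simp only [gw]
  rw [← Real.exp_add]
  congr 1
  ring

lemma gauss2 (R : ℝ) (hR : 0 < R) (v w : ℝ) :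
    ∫ p : ℝ × ℝ, (gw R p : ℂ) * ph p.1 p.2 v w
      = ((π * R ^ 2 * Real.exp (-R ^ 2 * (v ^ 2 + w ^ 2) / 4) : ℝ) : ℂ) := by
  have h : ∀ p : ℝ × ℝ, (gw R p : ℂ) * ph p.1 p.2 v w =
      (Complex.exp (Complex.I * v * p.1) * Complex.exp (-((1 / R ^ 2 : ℝ) : ℂ) * p.1 ^ 2)) *
      (Complex.exp (Complex.I * w * p.2) * Complex.exp (-((1 / R ^ 2 : ℝ) : ℂ) * p.2 ^ 2)) := by
    intro p
    unfold gw ph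
    rw [Complex.ofReal_exp]
    simp only [← Complex.exp_add]
    congr 1
    push_cast
    ring
  simp_rw [h]
  rw [Measure.volume_eq_prod,
    integral_prod_mul (fun x : ℝ => (Complex.exp (Complex.I * v * x) * Complex.exp (-((1 / R ^ 2 : ℝ) : ℂ) * x ^ 2)))
      (fun x : ℝ => (Complex.exp (Complex.I * w * x) * Complex.exp (-((1 / R ^ 2 : ℝ) : ℂ) * x ^ 2))), gauss1 R hR, gauss1 R hR, ← Complex.ofReal_mul]
  congr 1
  rw [show -R ^ 2 * (v ^ 2 + w ^ 2) / 4 = -R ^ 2 * v ^ 2 / 4 + -R ^ 2 * w ^ 2 / 4 by ring, Real.exp_add]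
  have := Real.mul_self_sqrt (show 0 ≤ π * R ^ 2 by positivity)
  linear_combination (Real.exp (-R ^ 2 * v ^ 2 / 4) * Real.exp (-R ^ 2 * w ^ 2 / 4)) * this

lemma ennreal_mul_le (a b : ℝ≥0∞) : a * b ≤ a ^ 2 + b ^ 2 := by
  rcases le_total a b with h | h
  · calc a * b ≤ b * b := by gcongr
      _ = b ^ 2 := (sq b).symm
      _ ≤ _ := le_add_self
  · calc a * b ≤ a * a := by gcongr
      _ = a ^ 2 := (sq a).symm
      _ ≤ _ := le_self_add

lemma schurE {Ω : Type*} [MeasurableSpace Ω] (ν : Measure Ω) [IsFiniteMeasure ν]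
    (H : Ω → ℂ) (hH : Measurable H) (M : ℝ) (hM : ∀ ω, ‖H ω‖ ≤ M) (a b : Ω → ℝ)
    (ha : Measurable a) (hb : Measurable b) (R : ℝ) (hR : 0 < R) :
    ∫⁻ p : ℝ × ℝ, ENNReal.ofReal (gw R p) * ‖∫ ω, H ω * ph p.1 p.2 (a ω) (b ω) ∂ν‖ₑ ^ 2
      ≤ ENNReal.ofReal (2 * π * R ^ 2) * ∫⁻ ω, ‖H ω‖ₑ ^ 2 *
        ∫⁻ ω', ENNReal.ofReal (Real.exp (-R ^ 2 * ((a ω - a ω') ^ 2 + (b ω - b ω') ^ 2) / 4)) ∂ν ∂ν := by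
  set E : ℝ × ℝ → ℂ := fun p => ∫ ω, H ω * ph p.1 p.2 (a ω) (b ω) ∂ν with hE
  set κ : Ω × Ω → ℝ := fun z =>
    Real.exp (-R ^ 2 * ((a z.1 - a z.2) ^ 2 + (b z.1 - b z.2) ^ 2) / 4) with hκ
  have hκm : Measurable κ := by
    simp only [hκ]; fun_prop
  have hphm : Measurable (fun z : (ℝ × ℝ) × Ω => ph z.1.1 z.1.2 (a z.2) (b z.2)) := by
    have : Measurable (fun z : (ℝ × ℝ) × Ω => (z.1.1, z.1.2, a z.2, b z.2)) := by fun_prop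
    exact continuous_ph.measurable.comp this
  -- integrand on the product
  set Q : (ℝ × ℝ) → (Ω × Ω) → ℂ := fun p z => (gw R p : ℂ) *
    ((H z.1 * ph p.1 p.2 (a z.1) (b z.1)) *
      (starRingEnd ℂ) (H z.2 * ph p.1 p.2 (a z.2) (b z.2))) with hQ
  have hQm : Measurable (Function.uncurry Q) := by
    have h1 : Measurable (fun z : (ℝ × ℝ) × (Ω × Ω) => H z.2.1 * ph z.1.1 z.1.2 (a z.2.1) (b z.2.1)) :=
      (hH.comp (by fun_prop)).mul (hphm.comp (g := fun z : (ℝ × ℝ) × Ω => ph z.1.1 z.1.2 (a z.2) (b z.2)) (f := fun z : (ℝ × ℝ) × (Ω × Ω) => (z.1, z.2.1)) (by fun_prop))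
    have h2 : Measurable (fun z : (ℝ × ℝ) × (Ω × Ω) => H z.2.2 * ph z.1.1 z.1.2 (a z.2.2) (b z.2.2)) :=
      (hH.comp (by fun_prop)).mul (hphm.comp (g := fun z : (ℝ × ℝ) × Ω => ph z.1.1 z.1.2 (a z.2) (b z.2)) (f := fun z : (ℝ × ℝ) × (Ω × Ω) => (z.1, z.2.2)) (by fun_prop))
    have h3 : Measurable (fun z : (ℝ × ℝ) × (Ω × Ω) => (gw R z.1 : ℂ)) :=
      Complex.measurable_ofReal.comp ((continuous_gw R).measurable.comp measurable_fst)
    exact h3.mul (h1.mul (Complex.continuous_conj.measurable.comp h2))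
  have hQn : ∀ p z, ‖Q p z‖ = gw R p * (‖H z.1‖ * ‖H z.2‖) := by
    intro p z
    simp only [hQ, norm_mul, norm_ph, RCLike.norm_conj, Complex.norm_real, mul_one,
      Real.norm_eq_abs, abs_of_pos (gw_pos R p)]
  have hM0 : ∀ z : Ω × Ω, ‖H z.1‖ * ‖H z.2‖ ≤ M * M := fun z =>
    mul_le_mul (hM _) (hM _) (norm_nonneg _) ((norm_nonneg _).trans (hM z.1))
  have hQi : Integrable (Function.uncurry Q) ((volume : Measure (ℝ × ℝ)).prod (ν.prod ν)) := by
    have h1 : Integrable (fun z : (ℝ × ℝ) × (Ω × Ω) => gw R z.1 * (M * M))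
        ((volume : Measure (ℝ × ℝ)).prod (ν.prod ν)) :=
      (gw_int R hR).mul_prod (integrable_const (M * M))
    refine h1.mono' hQm.aestronglyMeasurable (Eventually.of_forall fun z => ?_)
    rw [Function.uncurry, hQn]
    exact mul_le_mul_of_nonneg_left (hM0 _) (gw_pos _ _).le
  have hEE : ∀ p, ∫ z, Q p z ∂(ν.prod ν) = ((gw R p * ‖E p‖ ^ 2 : ℝ) : ℂ) := by
    intro p
    simp only [hQ]
    rw [integral_const_mul, integral_prod_mul (fun ω => H ω * ph p.1 p.2 (a ω) (b ω))
      (fun ω => (starRingEnd ℂ) (H ω * ph p.1 p.2 (a ω) (b ω))), integral_conj]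
    rw [Complex.mul_conj, Complex.normSq_eq_norm_sq]
    push_cast; rfl
  have hswap := integral_integral_swap hQi
  have hin : ∀ z : Ω × Ω, ∫ p, Q p z = (H z.1 * (starRingEnd ℂ) (H z.2)) * ((π * R ^ 2 * κ z : ℝ) : ℂ) := by
    intro z
    rw [hκ, ← gauss2 R hR, ← integral_const_mul]
    congr 1
    ext p
    simp only [hQ, map_mul, ← ph_mul_conj]
    ring
  have hEi : Integrable (fun p => gw R p * ‖E p‖ ^ 2) := by
    have := hQi.integral_prod_left
    simp only [Function.uncurry, hEE] at this
    have := this.re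
    simpa only [RCLike.re_eq_complex_re, Complex.ofReal_re] using this
  have e1 : ∫⁻ p : ℝ × ℝ, ENNReal.ofReal (gw R p) * ‖E p‖ₑ ^ 2
      = ENNReal.ofReal (∫ p, gw R p * ‖E p‖ ^ 2) := by
    rw [ofReal_integral_eq_lintegral_ofReal hEi
      (Eventually.of_forall fun p => mul_nonneg (gw_pos _ _).le (sq_nonneg _))]
    congr 1
    ext p
    rw [ENNReal.ofReal_mul (gw_pos _ _).le, ENNReal.ofReal_pow (norm_nonneg _), ofReal_norm]
  have e2 : ENNReal.ofReal (∫ p, gw R p * ‖E p‖ ^ 2) = ‖∫ z, ∫ p, Q p z ∂volume ∂(ν.prod ν)‖ₑ := by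
    rw [← hswap]
    simp_rw [hEE]
    rw [integral_complex_ofReal, ← ofReal_norm, Complex.norm_real, Real.norm_eq_abs, abs_of_nonneg]
    exact integral_nonneg fun p => mul_nonneg (gw_pos _ _).le (sq_nonneg _)
  rw [e1, e2]
  refine (enorm_integral_le_lintegral_enorm _).trans ?_
  have e3 : ∀ z : Ω × Ω, ‖∫ p, Q p z‖ₑ ≤ ENNReal.ofReal (π * R ^ 2) *
      (‖H z.1‖ₑ ^ 2 * ENNReal.ofReal (κ z) + ‖H z.2‖ₑ ^ 2 * ENNReal.ofReal (κ z)) := by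
    intro z
    rw [hin, enorm_mul, enorm_mul, ← ofReal_norm (((π * R ^ 2 * κ z : ℝ) : ℂ)), Complex.norm_real,
      Real.norm_eq_abs, abs_of_nonneg (by positivity), ENNReal.ofReal_mul (by positivity)]
    rw [show ‖(starRingEnd ℂ) (H z.2)‖ₑ = ‖H z.2‖ₑ from by
      rw [← ofReal_norm, RCLike.norm_conj, ofReal_norm]]
    rw [← add_mul, mul_left_comm]
    gcongr
    exact ennreal_mul_le _ _
  refine (lintegral_mono e3).trans ?_
  have hm1 : Measurable (fun z : Ω × Ω => ‖H z.1‖ₑ ^ 2 * ENNReal.ofReal (κ z)) :=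
    ((hH.comp measurable_fst).enorm.pow_const 2).mul hκm.ennreal_ofReal
  have hm2 : Measurable (fun z : Ω × Ω => ‖H z.2‖ₑ ^ 2 * ENNReal.ofReal (κ z)) :=
    ((hH.comp measurable_snd).enorm.pow_const 2).mul hκm.ennreal_ofReal
  rw [lintegral_const_mul' _ _ ENNReal.ofReal_ne_top, lintegral_add_left hm1]
  have f1 : ∫⁻ z, ‖H z.1‖ₑ ^ 2 * ENNReal.ofReal (κ z) ∂(ν.prod ν) =
      ∫⁻ ω, ‖H ω‖ₑ ^ 2 * ∫⁻ ω', ENNReal.ofReal (κ (ω, ω')) ∂ν ∂ν := by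
    rw [lintegral_prod _ hm1.aemeasurable]
    congr 1
    ext ω
    simp only
    rw [lintegral_const_mul]
    exact (hκm.comp (by fun_prop : Measurable (fun y : Ω => (ω, y)))).ennreal_ofReal
  have f2 : ∫⁻ z, ‖H z.2‖ₑ ^ 2 * ENNReal.ofReal (κ z) ∂(ν.prod ν) =
      ∫⁻ ω, ‖H ω‖ₑ ^ 2 * ∫⁻ ω', ENNReal.ofReal (κ (ω, ω')) ∂ν ∂ν := by
    rw [lintegral_prod_symm _ hm2.aemeasurable]
    congr 1
    ext ω
    simp only
    rw [lintegral_const_mul]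
    · congr 2
      ext y
      simp only [hκ]
      congr 3
      ring
    exact (hκm.comp (by fun_prop : Measurable (fun y : Ω => (y, ω)))).ennreal_ofReal
  rw [f1, f2, ← two_mul, ← mul_assoc]
  gcongr
  rw [show 2 * π * R ^ 2 = (π * R ^ 2) * 2 by ring, ENNReal.ofReal_mul (p := π * R ^ 2) (by positivity),
    ENNReal.ofReal_ofNat]

lemma gaussL (c m : ℝ) (hc : 0 < c) :
    ∫⁻ x : ℝ, ENNReal.ofReal (Real.exp (-c * (x - m) ^ 2)) = ENNReal.ofReal (√(π / c)) := by
  rw [lintegral_sub_right_eq_self (fun x => ENNReal.ofReal (Real.exp (-c * x ^ 2))) m,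
    ← integral_gaussian, ofReal_integral_eq_lintegral_ofReal (integrable_exp_neg_mul_sq hc)
      (Eventually.of_forall fun x => (Real.exp_pos _).le)]

/-- arc measure -/
def na (α : ℝ) : Measure ℝ := volume.restrict (Ioc α (α + π / 2))

instance (α : ℝ) : IsFiniteMeasure (na α) := by
  unfold na; infer_instance

/-- arc extension operator -/
def EA (α : ℝ) (G : ℝ → ℂ) (p : ℝ × ℝ) : ℂ :=
  ∫ φ, G φ * ph p.1 p.2 (Real.cos φ) (Real.sin φ) ∂(na α)

lemma sin_half_lb (x : ℝ) (hx : |x| ≤ π) : x ^ 2 / π ^ 2 ≤ Real.sin (x / 2) ^ 2 := by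
  have h := Real.mul_abs_le_abs_sin (x := x / 2) (by rw [abs_div, abs_two]; linarith)
  rw [abs_div, abs_two] at h
  have h2 : 2 / π * (|x| / 2) = |x| / π := by ring
  rw [h2] at h
  have h3 := pow_le_pow_left₀ (by positivity) h 2
  rwa [div_pow, sq_abs, sq_abs] at h3

lemma arc2 (x y : ℝ) (h : |x - y| ≤ π) :
    4 * (x - y) ^ 2 / π ^ 2 ≤ (Real.cos x - Real.cos y) ^ 2 + (Real.sin x - Real.sin y) ^ 2 := by
  have h1 := sin_half_lb _ h
  have h2 : (Real.cos x - Real.cos y) ^ 2 + (Real.sin x - Real.sin y) ^ 2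
      = 4 * Real.sin ((x - y) / 2) ^ 2 := by
    rw [Real.cos_sub_cos, Real.sin_sub_sin]
    have := Real.sin_sq_add_cos_sq ((x + y) / 2)
    linear_combination (4 * Real.sin ((x - y) / 2) ^ 2) * this
  rw [h2, mul_div_assoc]
  linarith

lemma arc4a (u d u' d' : ℝ) (hdd : |d| ≤ π / 4) (hdd' : |d'| ≤ π / 4)
    (h3 : |u - u'| ≤ π) :
    16 * ((d + d') ^ 2 / π ^ 2 * ((d - d') ^ 2 / π ^ 2)) + 16 * (1 / 2) * ((u - u') ^ 2 / π ^ 2) ≤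
    (2 * Real.cos u * Real.cos d - 2 * Real.cos u' * Real.cos d') ^ 2 +
      (2 * Real.sin u * Real.cos d - 2 * Real.sin u' * Real.cos d') ^ 2 := by
  have hpi := Real.pi_pos
  have hc : ∀ e : ℝ, |e| ≤ π / 4 → √2 / 2 ≤ Real.cos e := by
    intro e he
    rw [← Real.cos_pi_div_four, ← Real.cos_abs e]
    exact Real.cos_le_cos_of_nonneg_of_le_pi (abs_nonneg _) (by linarith) he
  have hcd := hc d hdd
  have hcd' := hc d' hdd'
  have hcc : 1 / 2 ≤ Real.cos d * Real.cos d' := by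
    have h2 : √2 * √2 = 2 := Real.mul_self_sqrt (by norm_num)
    have h4 := mul_le_mul hcd hcd' (by positivity) ((by positivity : (0:ℝ) ≤ √2 / 2).trans hcd)
    have h5 : √2 / 2 * (√2 / 2) = 1 / 2 := by linear_combination (1 / 4) * h2
    linarith
  have key : (2 * Real.cos u * Real.cos d - 2 * Real.cos u' * Real.cos d') ^ 2 +
      (2 * Real.sin u * Real.cos d - 2 * Real.sin u' * Real.cos d') ^ 2 =
      4 * (Real.cos d - Real.cos d') ^ 2 + 16 * (Real.cos d * Real.cos d') * Real.sin ((u - u') / 2) ^ 2 := by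
    have e5 : Real.sin ((u - u') / 2) ^ 2 = (1 - Real.cos (u - u')) / 2 := by
      rw [Real.sin_sq_eq_half_sub]
      rw [show 2 * ((u - u') / 2) = u - u' by ring]; ring
    rw [e5, Real.cos_sub]
    have s1 := Real.sin_sq_add_cos_sq u
    have s2 := Real.sin_sq_add_cos_sq u'
    linear_combination (4 * Real.cos d ^ 2) * s1 + (4 * Real.cos d' ^ 2) * s2
  rw [key, Real.cos_sub_cos]
  have q1 := sin_half_lb (d + d') ((abs_add_le _ _).trans (by linarith))
  have q2 := sin_half_lb (d - d') ((abs_sub _ _).trans (by linarith))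
  have q3 := sin_half_lb (u - u') h3
  have q4 := mul_le_mul q1 q2 (by positivity) (by positivity)
  have q5 : 16 * (1 / 2) * ((u - u') ^ 2 / π ^ 2) ≤
      16 * (Real.cos d * Real.cos d') * Real.sin ((u - u') / 2) ^ 2 := by
    apply mul_le_mul _ q3 (by positivity) (by linarith)
    linarith
  have q6 : 4 * (-2 * Real.sin ((d + d') / 2) * Real.sin ((d - d') / 2)) ^ 2 =
    16 * (Real.sin ((d + d') / 2) ^ 2 * Real.sin ((d - d') / 2) ^ 2) := by ring
  rw [q6]
  linarith

lemma arc4 (x y x' y' : ℝ) (h1 : |x - y| ≤ π / 2) (h2 : |x' - y'| ≤ π / 2)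
    (h3 : |x + y - (x' + y')| ≤ π) :
    ((x - y) ^ 2 - (x' - y') ^ 2) ^ 2 / π ^ 4 + 2 * (x + y - (x' + y')) ^ 2 / π ^ 2 ≤
    (Real.cos x + Real.cos y - (Real.cos x' + Real.cos y')) ^ 2 +
      (Real.sin x + Real.sin y - (Real.sin x' + Real.sin y')) ^ 2 := by
  have hpi := Real.pi_pos
  have h := arc4a ((x + y) / 2) ((x - y) / 2) ((x' + y') / 2) ((x' - y') / 2)
    (by rw [abs_div, abs_two]; linarith) (by rw [abs_div, abs_two]; linarith)
    (by rw [show (x + y) / 2 - (x' + y') / 2 = (x + y - (x' + y')) / 2 by ring, abs_div, abs_two]; linarith)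
  rw [Real.cos_add_cos x y, Real.cos_add_cos x' y', Real.sin_add_sin x y, Real.sin_add_sin x' y']
  refine le_trans (le_of_eq ?_) (h.trans (le_of_eq ?_))
  · ring
  · ring

/-- constant -/
def c2 : ℝ := 2 * π * (π * √π)

lemma c2_pos : 0 < c2 := by
  have := Real.pi_pos
  have := Real.sqrt_pos.2 this
  unfold c2; positivity

lemma arcs_sub {α x y : ℝ} (hx : x ∈ Ioc α (α + π / 2)) (hy : y ∈ Ioc α (α + π / 2)) :
    |x - y| ≤ π / 2 := by
  rw [abs_le]; constructor <;> linarith [hx.1, hx.2, hy.1, hy.2]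

lemma L2arc (α : ℝ) (G : ℝ → ℂ) (hG : Measurable G) (M : ℝ) (hM : ∀ φ, ‖G φ‖ ≤ M) (R : ℝ) (hR : 0 < R) :
    ∫⁻ p : ℝ × ℝ, ENNReal.ofReal (gw R p) * ‖EA α G p‖ₑ ^ 2 ≤
      ENNReal.ofReal (c2 * R) * ∫⁻ φ, ‖G φ‖ₑ ^ 2 ∂(na α) := by
  refine (schurE (na α) G hG M hM Real.cos Real.sin Real.measurable_cos Real.measurable_sin R hR).trans ?_
  have hpi := Real.pi_pos
  have hk : ∀ᵐ φ ∂(na α), ‖G φ‖ₑ ^ 2 * ∫⁻ ω', ENNReal.ofReal (Real.exp (-R ^ 2 * ((Real.cos φ - Real.cos ω') ^ 2 + (Real.sin φ - Real.sin ω') ^ 2) / 4)) ∂(na α) ≤ ‖G φ‖ₑ ^ 2 * ENNReal.ofReal (√π * π / R) := by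
    filter_upwards [ae_restrict_mem measurableSet_Ioc] with φ hφ
    gcongr
    calc ∫⁻ ω', ENNReal.ofReal (Real.exp (-R ^ 2 * ((Real.cos φ - Real.cos ω') ^ 2 + (Real.sin φ - Real.sin ω') ^ 2) / 4)) ∂(na α)
        ≤ ∫⁻ ω', ENNReal.ofReal (Real.exp (-(R ^ 2 / π ^ 2) * (ω' - φ) ^ 2)) ∂(na α) := by
          refine lintegral_mono_ae ?_
          filter_upwards [ae_restrict_mem measurableSet_Ioc] with ω hω
          apply ENNReal.ofReal_le_ofReal
          apply Real.exp_le_exp.2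
          have := arc2 φ ω ((arcs_sub hφ hω).trans (by linarith))
          have h2 := mul_le_mul_of_nonneg_left this (sq_nonneg R)
          have h3 : R ^ 2 * (4 * (φ - ω) ^ 2 / π ^ 2) = 4 * (R ^ 2 / π ^ 2 * (ω - φ) ^ 2) := by ring
          linarith
      _ ≤ ∫⁻ ω', ENNReal.ofReal (Real.exp (-(R ^ 2 / π ^ 2) * (ω' - φ) ^ 2)) :=
          lintegral_mono' Measure.restrict_le_self le_rfl
      _ = ENNReal.ofReal (√π * π / R) := by
          rw [gaussL _ _ (by positivity)]
          congr 1
          rw [show π / (R ^ 2 / π ^ 2) = π * (π / R) ^ 2 by field_simp, Real.sqrt_mul hpi.le,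
            Real.sqrt_sq (by positivity)]
          ring
  refine (mul_le_mul_right (lintegral_mono_ae hk) _).trans ?_
  rw [lintegral_mul_const' _ _ ENNReal.ofReal_ne_top, mul_comm (∫⁻ φ, ‖G φ‖ₑ ^ 2 ∂(na α)), ← mul_assoc, ← ENNReal.ofReal_mul (by positivity)]
  apply le_of_eq
  congr 2
  unfold c2
  field_simp

/-- kernel bound -/
def Wk (R w : ℝ) : ℝ := if |w| ≤ (√R)⁻¹ then √R else |w|⁻¹

lemma Wk_meas (R : ℝ) : Measurable (Wk R) := by
  unfold Wk
  refine Measurable.ite ?_ measurable_const (by fun_prop)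
  exact measurableSet_le (by fun_prop) measurable_const

lemma Wk_nonneg (R w : ℝ) : 0 ≤ Wk R w := by
  unfold Wk; split_ifs <;> positivity

lemma quart_int (c w : ℝ) (hc : 0 < c) :
    ∫⁻ v : ℝ, ENNReal.ofReal (Real.exp (-c ^ 2 * (w ^ 2 - v ^ 2) ^ 2)) ≤
      ENNReal.ofReal (2 * Real.exp 1 * √(π / (2 * c))) := by
  have h : ∀ v : ℝ, ENNReal.ofReal (Real.exp (-c ^ 2 * (w ^ 2 - v ^ 2) ^ 2)) ≤
      ENNReal.ofReal (Real.exp 1) * ENNReal.ofReal (Real.exp (-(2 * c) * (v - w) ^ 2)) +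
      ENNReal.ofReal (Real.exp 1) * ENNReal.ofReal (Real.exp (-(2 * c) * (v - (-w)) ^ 2)) := by
    intro v
    rw [← ENNReal.ofReal_mul (Real.exp_pos _).le, ← ENNReal.ofReal_mul (Real.exp_pos _).le,
      ← Real.exp_add, ← Real.exp_add]
    have hq : ∀ z : ℝ, z ^ 2 ≤ |w ^ 2 - v ^ 2| → -c ^ 2 * (w ^ 2 - v ^ 2) ^ 2 ≤ 1 + -(2 * c) * z ^ 2 := by
      intro z hz
      have h1 : (z ^ 2) ^ 2 ≤ (w ^ 2 - v ^ 2) ^ 2 := by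
        rw [← sq_abs (w ^ 2 - v ^ 2)]
        exact pow_le_pow_left₀ (sq_nonneg _) hz 2
      nlinarith [sq_nonneg (c * z ^ 2 - 1), mul_le_mul_of_nonneg_left h1 (sq_nonneg c)]
    rcases le_total 0 (v * w) with hs | hs
    · refine le_trans (ENNReal.ofReal_le_ofReal (Real.exp_le_exp.2 (hq (v - w) ?_))) le_self_add
      rw [show w ^ 2 - v ^ 2 = -((v - w) * (v + w)) by ring, abs_neg, abs_mul, ← sq_abs (v - w), sq]
      apply mul_le_mul_of_nonneg_left _ (abs_nonneg _)
      apply sq_le_sq.1; nlinarith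
    · refine le_trans (ENNReal.ofReal_le_ofReal (Real.exp_le_exp.2 (hq (v - (-w)) ?_))) le_add_self
      rw [show w ^ 2 - v ^ 2 = -((v + w) * (v - w)) by ring, abs_neg, abs_mul, ← sq_abs (v - (-w)), sq, sub_neg_eq_add]
      apply mul_le_mul_of_nonneg_left _ (abs_nonneg _)
      apply sq_le_sq.1; nlinarith
  refine (lintegral_mono h).trans ?_
  rw [lintegral_add_left (by fun_prop), lintegral_const_mul' _ _ ENNReal.ofReal_ne_top,
    lintegral_const_mul' _ _ ENNReal.ofReal_ne_top, gaussL _ _ (by positivity), gaussL _ _ (by positivity),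
    ← ENNReal.ofReal_mul (Real.exp_pos _).le, ← ENNReal.ofReal_add (by positivity) (by positivity)]
  apply le_of_eq; congr 1; ring

lemma quart_int2 (c w : ℝ) (hc : 0 < c) (hw : w ≠ 0) :
    ∫⁻ v : ℝ, ENNReal.ofReal (Real.exp (-c ^ 2 * (w ^ 2 - v ^ 2) ^ 2)) ≤
      ENNReal.ofReal (2 * (√π / (c * |w|))) := by
  have hw' : 0 < |w| := abs_pos.2 hw
  have h : ∀ v : ℝ, ENNReal.ofReal (Real.exp (-c ^ 2 * (w ^ 2 - v ^ 2) ^ 2)) ≤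
      ENNReal.ofReal (Real.exp (-(c * |w|) ^ 2 * (v - w) ^ 2)) +
      ENNReal.ofReal (Real.exp (-(c * |w|) ^ 2 * (v - (-w)) ^ 2)) := by
    intro v
    rw [mul_pow, sq_abs]
    rcases le_total 0 (v * w) with hs | hs
    · refine le_trans (ENNReal.ofReal_le_ofReal (Real.exp_le_exp.2 ?_)) le_self_add
      have : w ^ 2 ≤ (v + w) ^ 2 := by nlinarith [sq_nonneg v]
      have h2 := mul_le_mul_of_nonneg_left this (by positivity : 0 ≤ c ^ 2 * (v - w) ^ 2)
      have h3 : (w ^ 2 - v ^ 2) ^ 2 = (v - w) ^ 2 * (v + w) ^ 2 := by ring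
      rw [h3]; nlinarith
    · refine le_trans (ENNReal.ofReal_le_ofReal (Real.exp_le_exp.2 ?_)) le_add_self
      have : w ^ 2 ≤ (v - w) ^ 2 := by nlinarith [sq_nonneg v]
      have h2 := mul_le_mul_of_nonneg_left this (by positivity : 0 ≤ c ^ 2 * (v + w) ^ 2)
      have h3 : (w ^ 2 - v ^ 2) ^ 2 = (v - w) ^ 2 * (v + w) ^ 2 := by ring
      rw [h3, sub_neg_eq_add]; nlinarith
  refine (lintegral_mono h).trans ?_
  rw [lintegral_add_left (by fun_prop), gaussL _ _ (by positivity), gaussL _ _ (by positivity),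
    ← ENNReal.ofReal_add (by positivity) (by positivity)]
  apply le_of_eq; congr 1
  rw [Real.sqrt_div Real.pi_pos.le, Real.sqrt_sq (by positivity)]
  ring

/-- constant -/
def c4 : ℝ := 2 * π * √(π ^ 3 / 2) * (2 * Real.exp 1 * √(π ^ 3) + 4 * π ^ 2 * √π)

lemma c4_pos : 0 < c4 := by
  have := Real.pi_pos
  have := Real.sqrt_pos.2 this
  have := Real.exp_pos 1
  unfold c4; positivity

lemma ker_int (R w s : ℝ) (hR : 0 < R) :
    ∫⁻ B : ℝ, ∫⁻ A : ℝ, ENNReal.ofReal (Real.exp (-(R / (2 * π ^ 2)) ^ 2 * (w ^ 2 - (A - B) ^ 2) ^ 2)) *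
      ENNReal.ofReal (Real.exp (-(R ^ 2 / (2 * π ^ 2)) * (A + B - s) ^ 2)) =
    (∫⁻ v : ℝ, ENNReal.ofReal (Real.exp (-(R / (2 * π ^ 2)) ^ 2 * (w ^ 2 - v ^ 2) ^ 2))) *
      ENNReal.ofReal (√(π ^ 3 / 2) / R) := by
  have hpi := Real.pi_pos
  have h1 : ∀ B : ℝ, ∫⁻ A : ℝ, ENNReal.ofReal (Real.exp (-(R / (2 * π ^ 2)) ^ 2 * (w ^ 2 - (A - B) ^ 2) ^ 2)) *
      ENNReal.ofReal (Real.exp (-(R ^ 2 / (2 * π ^ 2)) * (A + B - s) ^ 2)) =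
      ∫⁻ v : ℝ, ENNReal.ofReal (Real.exp (-(R / (2 * π ^ 2)) ^ 2 * (w ^ 2 - v ^ 2) ^ 2)) *
      ENNReal.ofReal (Real.exp (-(2 * R ^ 2 / π ^ 2) * (B - (s - v) / 2) ^ 2)) := by
    intro B
    rw [← lintegral_add_right_eq_self _ B]
    congr 1
    ext v
    congr 3
    · congr 1; ring
    · ring
  simp_rw [h1]
  rw [lintegral_lintegral_swap]
  · have h2 : ∀ v : ℝ, ∫⁻ B : ℝ, ENNReal.ofReal (Real.exp (-(R / (2 * π ^ 2)) ^ 2 * (w ^ 2 - v ^ 2) ^ 2)) *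
        ENNReal.ofReal (Real.exp (-(2 * R ^ 2 / π ^ 2) * (B - (s - v) / 2) ^ 2)) =
        ENNReal.ofReal (Real.exp (-(R / (2 * π ^ 2)) ^ 2 * (w ^ 2 - v ^ 2) ^ 2)) *
        ENNReal.ofReal (√(π ^ 3 / 2) / R) := by
      intro v
      rw [lintegral_const_mul' _ _ ENNReal.ofReal_ne_top, gaussL _ _ (by positivity)]
      congr 2
      rw [show π / (2 * R ^ 2 / π ^ 2) = π ^ 3 / 2 / R ^ 2 by field_simp, Real.sqrt_div' _ (by positivity),
        Real.sqrt_sq hR.le]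
    simp_rw [h2]
    rw [lintegral_mul_const' _ _ ENNReal.ofReal_ne_top]
  · apply Measurable.aemeasurable
    unfold Function.uncurry
    fun_prop

lemma ker4 (α R : ℝ) (hR : 0 < R) (x y : ℝ) (hx : x ∈ Ioc α (α + π / 2)) (hy : y ∈ Ioc α (α + π / 2)) :
    ENNReal.ofReal (2 * π * R ^ 2) * ∫⁻ z : ℝ × ℝ, ENNReal.ofReal (Real.exp (-R ^ 2 *
      (((Real.cos x + Real.cos y) - (Real.cos z.1 + Real.cos z.2)) ^ 2 +
      ((Real.sin x + Real.sin y) - (Real.sin z.1 + Real.sin z.2)) ^ 2) / 4)) ∂((na α).prod (na α)) ≤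
    ENNReal.ofReal (c4 * Wk R (x - y)) := by
  have hpi := Real.pi_pos
  have hb : ∫⁻ z : ℝ × ℝ, ENNReal.ofReal (Real.exp (-R ^ 2 *
      (((Real.cos x + Real.cos y) - (Real.cos z.1 + Real.cos z.2)) ^ 2 +
      ((Real.sin x + Real.sin y) - (Real.sin z.1 + Real.sin z.2)) ^ 2) / 4)) ∂((na α).prod (na α)) ≤
      (∫⁻ v : ℝ, ENNReal.ofReal (Real.exp (-(R / (2 * π ^ 2)) ^ 2 * ((x - y) ^ 2 - v ^ 2) ^ 2))) *
      ENNReal.ofReal (√(π ^ 3 / 2) / R) := by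
    rw [← ker_int R (x - y) (x + y) hR, lintegral_prod_symm _ (by fun_prop)]
    have hna : na α ≤ volume := Measure.restrict_le_self
    refine le_trans (lintegral_mono_ae ?_) (lintegral_mono' hna le_rfl)
    filter_upwards [ae_restrict_mem measurableSet_Ioc] with B hB
    refine le_trans (lintegral_mono_ae ?_) (lintegral_mono' hna le_rfl)
    filter_upwards [ae_restrict_mem measurableSet_Ioc] with A hA
    rw [← ENNReal.ofReal_mul (Real.exp_pos _).le, ← Real.exp_add]
    apply ENNReal.ofReal_le_ofReal
    apply Real.exp_le_exp.2
    have h4 := arc4 x y A B (arcs_sub hx hy) (arcs_sub hA hB) (by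
      rw [abs_le]
      constructor <;> linarith [hx.1, hx.2, hy.1, hy.2, hA.1, hA.2, hB.1, hB.2])
    have h5 := mul_le_mul_of_nonneg_left h4 (sq_nonneg R)
    have h6 : -(R / (2 * π ^ 2)) ^ 2 * ((x - y) ^ 2 - (A - B) ^ 2) ^ 2 + -(R ^ 2 / (2 * π ^ 2)) * (A + B - (x + y)) ^ 2
      = -(R ^ 2 * (((x - y) ^ 2 - (A - B) ^ 2) ^ 2 / π ^ 4 + 2 * (x + y - (A + B)) ^ 2 / π ^ 2)) / 4 := by
      field_simp; ring
    rw [h6]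
    linarith
  refine (mul_le_mul_right hb _).trans ?_
  have hRs : √R * √R = R := Real.mul_self_sqrt hR.le
  have hRp : 0 < √R := Real.sqrt_pos.2 hR
  have hc0 : 0 ≤ 2 * π * √(π ^ 3 / 2) := by positivity
  by_cases hw : |x - y| ≤ (√R)⁻¹
  · refine (mul_le_mul_right (mul_le_mul_left (quart_int _ _ (by positivity)) _) _).trans ?_
    rw [← ENNReal.ofReal_mul (by positivity), ← ENNReal.ofReal_mul (by positivity)]
    apply ENNReal.ofReal_le_ofReal
    rw [Wk, if_pos hw, c4]
    have e1 : √(π / (2 * (R / (2 * π ^ 2)))) = √(π ^ 3) / √R := by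
      rw [← Real.sqrt_div' _ hR.le]; congr 1; field_simp
    rw [e1]
    have e2 : 2 * π * R ^ 2 * (2 * Real.exp 1 * (√(π ^ 3) / √R) * (√(π ^ 3 / 2) / R)) =
      2 * π * √(π ^ 3 / 2) * (2 * Real.exp 1 * √(π ^ 3)) * √R := by
      field_simp
      rw [sq, hRs]
    rw [e2]
    gcongr
    have : 0 ≤ 4 * π ^ 2 * √π := by positivity
    linarith
  · have hw0 : 0 < |x - y| := lt_of_lt_of_le (by positivity) (not_le.1 hw).le
    refine (mul_le_mul_right (mul_le_mul_left (quart_int2 _ _ (by positivity) (abs_pos.1 hw0)) _) _).trans ?_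
    rw [← ENNReal.ofReal_mul (by positivity), ← ENNReal.ofReal_mul (by positivity)]
    apply ENNReal.ofReal_le_ofReal
    rw [Wk, if_neg hw, c4]
    have e2 : 2 * π * R ^ 2 * (2 * (√π / (R / (2 * π ^ 2) * |x - y|)) * (√(π ^ 3 / 2) / R)) =
      2 * π * √(π ^ 3 / 2) * (4 * π ^ 2 * √π) * |x - y|⁻¹ := by
      field_simp
      ring
    rw [e2]
    gcongr
    have : 0 ≤ 2 * Real.exp 1 * √(π ^ 3) := by positivity
    linarith

lemma ph_add (x y a b a' b' : ℝ) : ph x y (a + a') (b + b') = ph x y a b * ph x y a' b' := by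
  unfold ph
  rw [← Complex.exp_add]
  congr 1
  push_cast
  ring

lemma L4arc (α : ℝ) (G : ℝ → ℂ) (hG : Measurable G) (M : ℝ) (hM : ∀ φ, ‖G φ‖ ≤ M) (R : ℝ) (hR : 0 < R) :
    ∫⁻ p : ℝ × ℝ, ENNReal.ofReal (gw R p) * ‖EA α G p‖ₑ ^ 4 ≤
      ∫⁻ x, ∫⁻ y, ‖G x‖ₑ ^ 2 * ‖G y‖ₑ ^ 2 * ENNReal.ofReal (c4 * Wk R (x - y)) ∂(na α) ∂(na α) := by
  have h := schurE ((na α).prod (na α)) (fun z => G z.1 * G z.2)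
    ((hG.comp measurable_fst).mul (hG.comp measurable_snd)) (M * M)
    (fun z => by
      rw [norm_mul]
      exact mul_le_mul (hM _) (hM _) (norm_nonneg _) ((norm_nonneg _).trans (hM z.1)))
    (fun z => Real.cos z.1 + Real.cos z.2) (fun z => Real.sin z.1 + Real.sin z.2)
    (by fun_prop) (by fun_prop) R hR
  have h1 : ∀ p : ℝ × ℝ, ∫ z : ℝ × ℝ, G z.1 * G z.2 * ph p.1 p.2 (Real.cos z.1 + Real.cos z.2) (Real.sin z.1 + Real.sin z.2) ∂((na α).prod (na α)) = EA α G p ^ 2 := by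
    intro p
    rw [sq, EA, ← integral_prod_mul]
    congr 1
    ext z
    rw [ph_add]; ring
  have h2 : ∀ p : ℝ × ℝ, ‖EA α G p ^ 2‖ₑ ^ 2 = ‖EA α G p‖ₑ ^ 4 := by
    intro p
    rw [enorm_pow, ← pow_mul]
  simp_rw [h1, h2] at h
  refine h.trans ?_
  rw [← lintegral_const_mul' _ _ ENNReal.ofReal_ne_top]
  have hWm := Wk_meas R
  rw [← lintegral_prod (μ := na α) (ν := na α) (fun z : ℝ × ℝ => ‖G z.1‖ₑ ^ 2 * ‖G z.2‖ₑ ^ 2 * ENNReal.ofReal (c4 * Wk R (z.1 - z.2)))]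
  · refine lintegral_mono_ae ?_
    have : ∀ᵐ z ∂((na α).prod (na α)), z.1 ∈ Ioc α (α + π / 2) ∧ z.2 ∈ Ioc α (α + π / 2) := by
      unfold na
      rw [Measure.prod_restrict]
      filter_upwards [ae_restrict_mem (measurableSet_Ioc.prod measurableSet_Ioc)] with z hz
      exact hz
    filter_upwards [this] with z hz
    rw [mul_left_comm, enorm_mul, mul_pow]
    exact mul_le_mul_right (ker4 α R hR z.1 z.2 hz.1 hz.2) _
  · apply Measurable.aemeasurable
    have a1 : Measurable (fun z : ℝ × ℝ => Wk R (z.1 - z.2)) := hWm.comp (by fun_prop)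
    exact (((hG.comp measurable_fst).enorm.pow_const 2).mul ((hG.comp measurable_snd).enorm.pow_const 2)).mul
      (a1.const_mul c4).ennreal_ofReal

lemma Wk_neg (R w : ℝ) : Wk R (-w) = Wk R w := by
  unfold Wk; rw [abs_neg]

lemma lint_rpow_Ioi (d s : ℝ) (hd : 0 < d) (hs : 1 < s) :
    ∫⁻ w, (Ioi d).indicator (fun w : ℝ => ENNReal.ofReal (w ^ (-s))) w =
      ENNReal.ofReal (d ^ (1 - s) / (s - 1)) := by
  rw [lintegral_indicator measurableSet_Ioi, ← ofReal_integral_eq_lintegral_ofReal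
    (integrableOn_Ioi_rpow_of_lt (by linarith) hd), integral_Ioi_rpow_of_lt (by linarith) hd]
  · congr 1
    rw [show -s + 1 = 1 - s by ring, show s - 1 = -(1 - s) by ring, div_neg, neg_div]
  · filter_upwards [ae_restrict_mem measurableSet_Ioi] with w hw
    have : 0 < w := hd.trans hw
    positivity

lemma Wk_int (R s : ℝ) (hR : 0 < R) (hs : 1 < s) :
    ∫⁻ w : ℝ, ENNReal.ofReal (Wk R w) ^ s ≤ ENNReal.ofReal ((2 + 2 / (s - 1)) * R ^ ((s - 1) / 2)) := by
  have hRp : 0 < √R := Real.sqrt_pos.2 hR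
  set d := (√R)⁻¹ with hd
  have hd0 : 0 < d := by positivity
  set A2 : ℝ → ℝ≥0∞ := (Ioi d).indicator (fun w : ℝ => ENNReal.ofReal (w ^ (-s))) with hA2
  have hA2m : Measurable A2 := by
    apply Measurable.indicator _ measurableSet_Ioi
    fun_prop
  set A1 : ℝ → ℝ≥0∞ := (Icc (-d) d).indicator (fun w : ℝ => ENNReal.ofReal (√R ^ s)) with hA1
  have hA1m : Measurable A1 := by
    apply Measurable.indicator _ measurableSet_Icc
    fun_prop
  have hle : ∀ w : ℝ, ENNReal.ofReal (Wk R w) ^ s ≤ A1 w + (A2 w + A2 (-w)) := by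
    intro w
    rw [ENNReal.ofReal_rpow_of_nonneg (Wk_nonneg R w) (by linarith)]
    unfold Wk
    split_ifs with h
    · refine le_trans ?_ le_self_add
      rw [hA1, indicator_of_mem (show w ∈ Icc (-d) d from abs_le.1 h)]
    · refine le_trans ?_ le_add_self
      rcases lt_abs.1 (not_le.1 h) with h1 | h1
      · refine le_trans ?_ le_self_add
        rw [hA2, indicator_of_mem (show w ∈ Ioi d from h1)]
        have : 0 < w := hd0.trans h1
        rw [abs_of_pos this, Real.inv_rpow this.le, Real.rpow_neg this.le]
      · refine le_trans ?_ le_add_self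
        rw [hA2, indicator_of_mem (show -w ∈ Ioi d from h1)]
        have : 0 < -w := hd0.trans h1
        rw [← abs_neg, abs_of_pos this, Real.inv_rpow this.le, Real.rpow_neg this.le]
  refine (lintegral_mono hle).trans ?_
  rw [lintegral_add_left hA1m, lintegral_add_left hA2m, lintegral_neg_eq_self A2, hA2, lint_rpow_Ioi d s hd0 hs,
    hA1, lintegral_indicator measurableSet_Icc, lintegral_const, Measure.restrict_apply_univ, Real.volume_Icc]
  have h1 : 0 ≤ d ^ (1 - s) / (s - 1) := div_nonneg (by positivity) (by linarith)
  rw [← ENNReal.ofReal_mul (by positivity), ← ENNReal.ofReal_add h1 h1, ← ENNReal.ofReal_add (mul_nonneg (by positivity) (by linarith)) (by linarith)]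
  apply le_of_eq; congr 1
  have e1 : d ^ (1 - s) = R ^ ((s - 1) / 2) := by
    rw [hd, Real.sqrt_eq_rpow, ← Real.rpow_neg hR.le, ← Real.rpow_mul hR.le]
    congr 1; ring
  have e2 : √R ^ s * d = R ^ ((s - 1) / 2) := by
    rw [hd, Real.sqrt_eq_rpow, ← Real.rpow_neg hR.le, ← Real.rpow_mul hR.le, ← Real.rpow_add hR]
    congr 1; ring
  rw [e1]
  linear_combination 2 * e2

lemma enorm_sq_ofReal (z : ℂ) : ‖z‖ₑ ^ 2 = ENNReal.ofReal (‖z‖ ^ 2) := by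
  rw [ENNReal.ofReal_pow (norm_nonneg _), ofReal_norm]

/-- constant -/
def ch (η : ℝ) : ℝ := (2 + 2 / ((1 - η)⁻¹ - 1)) ^ (1 - η)

lemma inner_holder (α η r : ℝ) (hη : 0 < η) (hη1 : η < 1) (hrη : r * η ≤ 2)
    (G : ℝ → ℂ) (hG : Measurable G) (hint : ∫⁻ φ, ENNReal.ofReal (‖G φ‖ ^ r) ∂(na α) ≤ 1)
    (R : ℝ) (hR : 0 < R) (x : ℝ) :
    ∫⁻ y, ({y | ‖G y‖ ≤ ‖G x‖}.indicator (fun y => ‖G y‖ₑ ^ 2) y) * ENNReal.ofReal (Wk R (x - y)) ∂(na α) ≤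
      ENNReal.ofReal (‖G x‖ ^ (2 - r * η)) * ENNReal.ofReal (ch η * R ^ (η / 2)) := by
  have hη' : 0 < 1 - η := by linarith
  have hconj : (η⁻¹).HolderConjugate ((1 - η)⁻¹) := by
    rw [Real.holderConjugate_iff]
    refine ⟨(one_lt_inv₀ hη).2 hη1, ?_⟩
    rw [inv_inv, inv_inv]; ring
  set f : ℝ → ℝ≥0∞ := {y | ‖G y‖ ≤ ‖G x‖}.indicator (fun y => ‖G y‖ₑ ^ 2) with hf
  have hfm : Measurable f :=
    (hG.enorm.pow_const 2).indicator (measurableSet_le hG.norm measurable_const)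
  have hgm : Measurable (fun y => ENNReal.ofReal (Wk R (x - y))) :=
    ((Wk_meas R).comp (by fun_prop)).ennreal_ofReal
  refine (ENNReal.lintegral_mul_le_Lp_mul_Lq (na α) hconj hfm.aemeasurable hgm.aemeasurable).trans ?_
  have hex : 0 ≤ 2 / η - r := by
    rw [sub_nonneg, le_div_iff₀ hη]; exact hrη
  have b1 : ∫⁻ y, f y ^ η⁻¹ ∂(na α) ≤ ENNReal.ofReal (‖G x‖ ^ (2 / η - r)) := by
    calc ∫⁻ y, f y ^ η⁻¹ ∂(na α) ≤ ∫⁻ y, ENNReal.ofReal (‖G x‖ ^ (2 / η - r)) * ENNReal.ofReal (‖G y‖ ^ r) ∂(na α) := by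
          refine lintegral_mono fun y => ?_
          by_cases hy : ‖G y‖ ≤ ‖G x‖
          · rw [hf, indicator_of_mem (show y ∈ {y | ‖G y‖ ≤ ‖G x‖} from hy), enorm_sq_ofReal, ENNReal.ofReal_rpow_of_nonneg (by positivity) (by positivity), ← ENNReal.ofReal_mul (by positivity)]
            apply ENNReal.ofReal_le_ofReal
            rcases (norm_nonneg (G y)).eq_or_lt with h0 | h0
            · rw [← h0, zero_pow two_ne_zero, Real.zero_rpow (by positivity)]
              positivity
            · rw [← Real.rpow_natCast, ← Real.rpow_mul h0.le]
              rw [show ((2:ℕ):ℝ) * η⁻¹ = (2 / η - r) + r by push_cast; ring, Real.rpow_add h0]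
              gcongr
          · rw [hf, indicator_of_notMem (show y ∉ {y | ‖G y‖ ≤ ‖G x‖} from hy), ENNReal.zero_rpow_of_pos (by positivity)]
            exact zero_le
      _ = ENNReal.ofReal (‖G x‖ ^ (2 / η - r)) * ∫⁻ y, ENNReal.ofReal (‖G y‖ ^ r) ∂(na α) :=
          lintegral_const_mul' _ _ ENNReal.ofReal_ne_top
      _ ≤ ENNReal.ofReal (‖G x‖ ^ (2 / η - r)) * 1 := by gcongr
      _ = _ := mul_one _
  have b2 : ∫⁻ y, ENNReal.ofReal (Wk R (x - y)) ^ (1 - η)⁻¹ ∂(na α) ≤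
      ENNReal.ofReal ((2 + 2 / ((1 - η)⁻¹ - 1)) * R ^ (((1 - η)⁻¹ - 1) / 2)) := by
    refine le_trans (lintegral_mono' Measure.restrict_le_self le_rfl) ?_
    rw [lintegral_sub_left_eq_self (fun y => ENNReal.ofReal (Wk R y) ^ (1 - η)⁻¹) x]
    exact Wk_int R _ hR hconj.symm.lt
  have hs := hconj.symm.lt
  have hs' : 0 ≤ 2 + 2 / ((1 - η)⁻¹ - 1) := by
    have : 0 < (1 - η)⁻¹ - 1 := by linarith
    positivity
  rw [one_div, one_div, inv_inv, inv_inv]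
  refine (mul_le_mul' (ENNReal.rpow_le_rpow b1 hη.le) (ENNReal.rpow_le_rpow b2 hη'.le)).trans ?_
  rw [ENNReal.ofReal_rpow_of_nonneg (by positivity) hη.le, ENNReal.ofReal_rpow_of_nonneg (by positivity) hη'.le]
  apply le_of_eq
  congr 2
  · rw [← Real.rpow_mul (norm_nonneg _)]
    congr 1; field_simp
  · rw [Real.mul_rpow hs' (by positivity), ← Real.rpow_mul hR.le, ch]
    congr 2
    field_simp; ring

lemma sym_dbl (μ : Measure ℝ) [SFinite μ] (T : ℝ → ℝ → ℝ≥0∞) (hT : Measurable (Function.uncurry T))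
    (c : ℝ≥0∞) (hc : c ≠ ∞) :
    ∫⁻ x, ∫⁻ y, c * (T x y + T y x) ∂μ ∂μ = c * (2 * ∫⁻ x, ∫⁻ y, T x y ∂μ ∂μ) := by
  simp_rw [lintegral_const_mul' _ _ hc]
  have h1 : ∀ x, ∫⁻ y, T x y + T y x ∂μ = ∫⁻ y, T x y ∂μ + ∫⁻ y, T y x ∂μ := by
    intro x
    apply lintegral_add_left
    exact hT.comp (by fun_prop : Measurable (fun y : ℝ => (x, y)))
  simp_rw [h1]
  have hm : Measurable (fun x => ∫⁻ y, T x y ∂μ) := Measurable.lintegral_prod_right hT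
  rw [lintegral_add_left hm, lintegral_lintegral_swap (f := fun x y => T y x), two_mul]
  exact (hT.comp measurable_swap).aemeasurable

lemma L4eta (α η r : ℝ) (hη : 0 < η) (hη1 : η < 1) (hrη : r * η ≤ 2)
    (G : ℝ → ℂ) (hG : Measurable G) (M : ℝ) (hM : ∀ φ, ‖G φ‖ ≤ M)
    (hint : ∫⁻ φ, ENNReal.ofReal (‖G φ‖ ^ r) ∂(na α) ≤ 1) (R : ℝ) (hR : 0 < R) :
    ∫⁻ p : ℝ × ℝ, ENNReal.ofReal (gw R p) * ‖EA α G p‖ₑ ^ 4 ≤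
      ENNReal.ofReal (2 * c4 * ch η * R ^ (η / 2)) * ∫⁻ x, ENNReal.ofReal (‖G x‖ ^ (4 - r * η)) ∂(na α) := by
  refine (L4arc α G hG M hM R hR).trans ?_
  have hηs : 0 < 1 - η := by linarith
  have hch : 0 ≤ ch η := by
    unfold ch
    have : 1 < (1 - η)⁻¹ := (one_lt_inv₀ hηs).2 (by linarith)
    have : 0 < (1 - η)⁻¹ - 1 := by linarith
    positivity
  set T : ℝ → ℝ → ℝ≥0∞ := fun x y => ‖G x‖ₑ ^ 2 * (({y | ‖G y‖ ≤ ‖G x‖}.indicator (fun y => ‖G y‖ₑ ^ 2) y) * ENNReal.ofReal (Wk R (x - y))) with hT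
  have hTm : Measurable (Function.uncurry T) := by
    have a1 : Measurable (fun z : ℝ × ℝ => Wk R (z.1 - z.2)) := (Wk_meas R).comp (by fun_prop)
    have a2 : Measurable (fun z : ℝ × ℝ => ‖G z.1‖ₑ ^ 2) := (hG.comp measurable_fst).enorm.pow_const 2
    have a3 : Measurable (fun z : ℝ × ℝ => ‖G z.2‖ₑ ^ 2) := (hG.comp measurable_snd).enorm.pow_const 2
    have a4 := a3.indicator (measurableSet_le (hG.comp measurable_snd).norm (hG.comp measurable_fst).norm)
    exact a2.mul (a4.mul a1.ennreal_ofReal)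
  have hpt : ∀ x y, ‖G x‖ₑ ^ 2 * ‖G y‖ₑ ^ 2 * ENNReal.ofReal (c4 * Wk R (x - y)) ≤
      ENNReal.ofReal c4 * (T x y + T y x) := by
    intro x y
    rw [ENNReal.ofReal_mul c4_pos.le, mul_left_comm]
    gcongr
    rcases le_total ‖G y‖ ‖G x‖ with h | h
    · refine le_trans ?_ le_self_add
      simp only [hT]
      rw [indicator_of_mem (show y ∈ {y | ‖G y‖ ≤ ‖G x‖} from h), mul_assoc]
    · refine le_trans ?_ le_add_self
      simp only [hT]
      rw [indicator_of_mem (show x ∈ {x | ‖G x‖ ≤ ‖G y‖} from h), ← neg_sub x y, Wk_neg]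
      apply le_of_eq; ring
  have hsum : ∫⁻ x, ∫⁻ y, T x y ∂(na α) ∂(na α) ≤
      ENNReal.ofReal (ch η * R ^ (η / 2)) * ∫⁻ x, ENNReal.ofReal (‖G x‖ ^ (4 - r * η)) ∂(na α) := by
    rw [← lintegral_const_mul' _ _ ENNReal.ofReal_ne_top]
    refine lintegral_mono fun x => ?_
    simp only [hT]
    rw [lintegral_const_mul' _ _ (by simp)]
    refine (mul_le_mul_right (inner_holder α η r hη hη1 hrη G hG hint R hR x) _).trans ?_
    rw [← mul_assoc, mul_comm]
    gcongr
    rw [enorm_sq_ofReal, ← ENNReal.ofReal_mul (by positivity)]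
    apply ENNReal.ofReal_le_ofReal
    rw [← Real.rpow_natCast, ← Real.rpow_add_of_nonneg (norm_nonneg _) (by norm_num) (by linarith)]
    apply le_of_eq; congr 1; push_cast; ring
  calc _ ≤ ∫⁻ x, ∫⁻ y, ENNReal.ofReal c4 * (T x y + T y x) ∂(na α) ∂(na α) :=
        lintegral_mono fun x => lintegral_mono fun y => hpt x y
    _ = ENNReal.ofReal c4 * (2 * ∫⁻ x, ∫⁻ y, T x y ∂(na α) ∂(na α)) :=
        sym_dbl (na α) T hTm _ ENNReal.ofReal_ne_top
    _ ≤ ENNReal.ofReal c4 * (2 * (ENNReal.ofReal (ch η * R ^ (η / 2)) * ∫⁻ x, ENNReal.ofReal (‖G x‖ ^ (4 - r * η)) ∂(na α))) := by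
        gcongr
    _ = _ := by
        rw [show 2 * c4 * ch η * R ^ (η / 2) = c4 * (2 * (ch η * R ^ (η / 2))) by ring,
          ENNReal.ofReal_mul c4_pos.le, ENNReal.ofReal_mul (p := 2) (by norm_num), ENNReal.ofReal_ofNat]
        ring

/-- circle measure -/
def nu : Measure ℝ := volume.restrict (Ioc (0:ℝ) (2 * π))

instance : IsFiniteMeasure nu := by
  unfold nu; infer_instance

lemma restrict_Ioc_add (a b c : ℝ) (h1 : a ≤ b) (h2 : b ≤ c) :
    (volume : Measure ℝ).restrict (Ioc a c) = volume.restrict (Ioc a b) + volume.restrict (Ioc b c) := by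
  rw [← Ioc_union_Ioc_eq_Ioc h1 h2, Measure.restrict_union (Ioc_disjoint_Ioc_of_le le_rfl) measurableSet_Ioc]

lemma nu_eq : nu = (na 0 + na (π / 2)) + (na π + na (3 * π / 2)) := by
  have := Real.pi_pos
  unfold nu na
  rw [restrict_Ioc_add 0 π (2 * π) this.le (by linarith), restrict_Ioc_add 0 (π / 2) π (by linarith) (by linarith),
    restrict_Ioc_add π (3 * π / 2) (2 * π) (by linarith) (by linarith)]
  congr 3 <;> congr 2 <;> ring

/-- full extension operator -/
def EF (G : ℝ → ℂ) (p : ℝ × ℝ) : ℂ :=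
  ∫ φ, G φ * ph p.1 p.2 (Real.cos φ) (Real.sin φ) ∂nu

lemma Rext_eq (F : ℝ → ℂ) (p : ℝ × ℝ) : Rext F p.1 p.2 = Complex.ofReal (1 / (2 * π)) * EF F p := by
  unfold Rext EF nu ph
  rw [intervalIntegral.integral_of_le (by positivity)]

lemma measurable_phφ (p : ℝ × ℝ) : Measurable (fun φ => ph p.1 p.2 (Real.cos φ) (Real.sin φ)) := by
  unfold ph
  fun_prop

lemma integrable_mul_ph (μ : Measure ℝ) (G : ℝ → ℂ) (hG : Integrable G μ) (p : ℝ × ℝ) :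
    Integrable (fun φ => G φ * ph p.1 p.2 (Real.cos φ) (Real.sin φ)) μ := by
  refine hG.mono (hG.1.mul (measurable_phφ p).aestronglyMeasurable) (Eventually.of_forall fun φ => ?_)
  rw [norm_mul, norm_ph, mul_one]

lemma integrable_bdd (μ : Measure ℝ) [IsFiniteMeasure μ] (G : ℝ → ℂ) (hG : Measurable G) (M : ℝ) (hM : ∀ φ, ‖G φ‖ ≤ M) :
    Integrable G μ :=
  Integrable.of_bound hG.aestronglyMeasurable M (Eventually.of_forall hM)

lemma EF_split (G : ℝ → ℂ) (hG : Measurable G) (M : ℝ) (hM : ∀ φ, ‖G φ‖ ≤ M) (p : ℝ × ℝ) :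
    EF G p = (EA 0 G p + EA (π / 2) G p) + (EA π G p + EA (3 * π / 2) G p) := by
  have h : ∀ μ : Measure ℝ, [IsFiniteMeasure μ] → Integrable (fun φ => G φ * ph p.1 p.2 (Real.cos φ) (Real.sin φ)) μ :=
    fun μ _ => integrable_mul_ph μ G (integrable_bdd μ G hG M hM) p
  unfold EF EA
  rw [nu_eq, integral_add_measure (h _) (h _), integral_add_measure (h _) (h _), integral_add_measure (h _) (h _)]

lemma EA_meas (α : ℝ) (G : ℝ → ℂ) (hG : Measurable G) : Measurable (EA α G) := by
  unfold EA
  have : StronglyMeasurable (Function.uncurry fun (p : ℝ × ℝ) (φ : ℝ) => G φ * ph p.1 p.2 (Real.cos φ) (Real.sin φ)) := by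
    apply Measurable.stronglyMeasurable
    unfold ph Function.uncurry
    fun_prop
  exact (this.integral_prod_right (ν := na α)).measurable

/-- dyadic annuli -/
def Ak (k : ℕ) : Set (ℝ × ℝ) := {p | (2:ℝ) ^ k ≤ 1 + |p.1| + |p.2| ∧ 1 + |p.1| + |p.2| < 2 ^ (k + 1)}

lemma Ak_gw (k : ℕ) (p : ℝ × ℝ) (hp : p ∈ Ak k) : Real.exp (-4) ≤ gw (2 ^ k) p := by
  unfold gw
  apply Real.exp_le_exp.2
  have h := hp.2
  rw [pow_succ] at h
  have h0 : (0:ℝ) < 2 ^ k := by positivity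
  rw [le_div_iff₀ (by positivity)]
  have h1 : p.1 ^ 2 + p.2 ^ 2 ≤ (2 ^ k * 2) ^ 2 := by
    have := abs_nonneg p.1
    have := abs_nonneg p.2
    rw [← sq_abs p.1, ← sq_abs p.2]
    nlinarith [mul_nonneg (abs_nonneg p.1) (abs_nonneg p.2)]
  linarith

lemma markov_arc (n : ℕ) (α : ℝ) (G : ℝ → ℂ) (hG : Measurable G) (k : ℕ) (σ : ℝ) (hσ : 0 < σ) :
    volume (Ak k ∩ {p | σ < ‖EA α G p‖}) ≤
      ENNReal.ofReal (Real.exp 4 * (σ⁻¹) ^ n) * ∫⁻ p : ℝ × ℝ, ENNReal.ofReal (gw (2 ^ k) p) * ‖EA α G p‖ₑ ^ n := by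
  rw [← lintegral_const_mul' _ _ ENNReal.ofReal_ne_top]
  refine meas_le_lintegral₀ ?_ ?_
  · have := (EA_meas α G hG).enorm.pow_const n
    have h2 := (continuous_gw (2 ^ k)).measurable.ennreal_ofReal
    exact ((h2.mul this).const_mul _).aemeasurable
  · rintro p ⟨h1, h2⟩
    have h3 := Ak_gw k p h1
    rw [← ofReal_norm, ← ENNReal.ofReal_pow (norm_nonneg _), ← ENNReal.ofReal_mul (gw_pos _ _).le,
      ← ENNReal.ofReal_mul (by positivity), ENNReal.one_le_ofReal]
    have h4 : 1 ≤ (σ⁻¹ * ‖EA α G p‖) ^ n := by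
      apply one_le_pow₀
      rw [inv_mul_eq_div, one_le_div hσ]
      exact le_of_lt h2
    have h5 : 1 ≤ Real.exp 4 * gw (2 ^ k) p := by
      calc (1:ℝ) = Real.exp 4 * Real.exp (-4) := by rw [← Real.exp_add]; simp
        _ ≤ _ := by gcongr
    calc (1:ℝ) ≤ (Real.exp 4 * gw (2 ^ k) p) * (σ⁻¹ * ‖EA α G p‖) ^ n := one_le_mul_of_one_le_of_one_le h5 h4
      _ = _ := by rw [mul_pow]; ring

lemma four_arcs (G : ℝ → ℂ) (hG : Measurable G) (M : ℝ) (hM : ∀ φ, ‖G φ‖ ≤ M) (k : ℕ) (σ : ℝ) :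
    volume (Ak k ∩ {p | σ < ‖EF G p‖}) ≤
      (volume (Ak k ∩ {p | σ / 4 < ‖EA 0 G p‖}) + volume (Ak k ∩ {p | σ / 4 < ‖EA (π / 2) G p‖})) +
      (volume (Ak k ∩ {p | σ / 4 < ‖EA π G p‖}) + volume (Ak k ∩ {p | σ / 4 < ‖EA (3 * π / 2) G p‖})) := by
  have : Ak k ∩ {p | σ < ‖EF G p‖} ⊆ ((Ak k ∩ {p | σ / 4 < ‖EA 0 G p‖}) ∪ (Ak k ∩ {p | σ / 4 < ‖EA (π / 2) G p‖})) ∪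
      ((Ak k ∩ {p | σ / 4 < ‖EA π G p‖}) ∪ (Ak k ∩ {p | σ / 4 < ‖EA (3 * π / 2) G p‖})) := by
    rintro p ⟨h1, h2⟩
    simp only [mem_union, mem_inter_iff, mem_setOf_eq, h1, true_and] at h2 ⊢
    by_contra hc
    push Not at hc
    rw [EF_split G hG M hM] at h2
    have e1 := norm_add_le (EA 0 G p + EA (π / 2) G p) (EA π G p + EA (3 * π / 2) G p)
    have e2 := norm_add_le (EA 0 G p) (EA (π / 2) G p)
    have e3 := norm_add_le (EA π G p) (EA (3 * π / 2) G p)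
    linarith [hc.1.1, hc.1.2, hc.2.1, hc.2.2]
  refine (measure_mono this).trans ((measure_union_le _ _).trans ?_)
  gcongr <;> exact measure_union_le _ _

lemma sum_arcs (f : ℝ → ℝ≥0∞) (c : ℝ≥0∞) :
    (c * ∫⁻ x, f x ∂(na 0) + c * ∫⁻ x, f x ∂(na (π / 2))) + (c * ∫⁻ x, f x ∂(na π) + c * ∫⁻ x, f x ∂(na (3 * π / 2))) =
    c * ∫⁻ x, f x ∂nu := by
  rw [nu_eq, lintegral_add_measure, lintegral_add_measure, lintegral_add_measure]
  ring

lemma na_le (α : ℝ) (h0 : 0 ≤ α) (h1 : α ≤ 3 * π / 2) : na α ≤ nu := by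
  unfold na nu
  apply Measure.restrict_mono _ le_rfl
  apply Ioc_subset_Ioc h0
  linarith

lemma core2 : ∃ C : ℝ, 0 < C ∧ ∀ (G : ℝ → ℂ), Measurable G → ∀ M : ℝ, (∀ φ, ‖G φ‖ ≤ M) → ∀ (k : ℕ) (σ : ℝ), 0 < σ →
    volume (Ak k ∩ {p | σ < ‖EF G p‖}) ≤
      ENNReal.ofReal (C * (σ ^ 2)⁻¹ * 2 ^ k) * ∫⁻ φ, ‖G φ‖ₑ ^ 2 ∂nu := by
  refine ⟨16 * Real.exp 4 * c2, by have := c2_pos; positivity, ?_⟩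
  intro G hG M hM k σ hσ
  have key : ∀ α, volume (Ak k ∩ {p | σ / 4 < ‖EA α G p‖}) ≤
      ENNReal.ofReal (16 * Real.exp 4 * c2 * (σ ^ 2)⁻¹ * 2 ^ k) * ∫⁻ φ, ‖G φ‖ₑ ^ 2 ∂(na α) := by
    intro α
    refine (markov_arc 2 α G hG k (σ / 4) (by positivity)).trans ?_
    refine (mul_le_mul_right (L2arc α G hG M hM (2 ^ k) (by positivity)) _).trans ?_
    rw [← mul_assoc, ← ENNReal.ofReal_mul (by positivity)]
    apply le_of_eq; congr 2
    field_simp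
    ring
  refine (four_arcs G hG M hM k σ).trans ?_
  rw [← sum_arcs]
  gcongr <;> exact key _

lemma core4 (η r : ℝ) (hη : 0 < η) (hη1 : η < 1) (hrη : r * η ≤ 2) :
    ∃ C : ℝ, 0 < C ∧ ∀ (G : ℝ → ℂ), Measurable G → ∀ M : ℝ, (∀ φ, ‖G φ‖ ≤ M) →
    ∫⁻ φ, ENNReal.ofReal (‖G φ‖ ^ r) ∂nu ≤ 1 → ∀ (k : ℕ) (σ : ℝ), 0 < σ →
    volume (Ak k ∩ {p | σ < ‖EF G p‖}) ≤
      ENNReal.ofReal (C * (σ ^ 4)⁻¹ * (2 ^ k) ^ (η / 2)) * ∫⁻ φ, ENNReal.ofReal (‖G φ‖ ^ (4 - r * η)) ∂nu := by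
  have hch : 0 < ch η := by
    unfold ch
    have hηs : 0 < 1 - η := by linarith
    have : 1 < (1 - η)⁻¹ := (one_lt_inv₀ hηs).2 (by linarith)
    have : 0 < (1 - η)⁻¹ - 1 := by linarith
    positivity
  refine ⟨256 * Real.exp 4 * (2 * c4 * ch η), by have := c4_pos; positivity, ?_⟩
  intro G hG M hM hint k σ hσ
  have key : ∀ α, 0 ≤ α → α ≤ 3 * π / 2 → volume (Ak k ∩ {p | σ / 4 < ‖EA α G p‖}) ≤
      ENNReal.ofReal (256 * Real.exp 4 * (2 * c4 * ch η) * (σ ^ 4)⁻¹ * (2 ^ k) ^ (η / 2)) * ∫⁻ φ, ENNReal.ofReal (‖G φ‖ ^ (4 - r * η)) ∂(na α) := by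
    intro α h0 h1
    refine (markov_arc 4 α G hG k (σ / 4) (by positivity)).trans ?_
    have hi : ∫⁻ φ, ENNReal.ofReal (‖G φ‖ ^ r) ∂(na α) ≤ 1 := (lintegral_mono' (na_le α h0 h1) le_rfl).trans hint
    refine (mul_le_mul_right (L4eta α η r hη hη1 hrη G hG M hM hi (2 ^ k) (by positivity)) _).trans ?_
    rw [← mul_assoc, ← ENNReal.ofReal_mul (by positivity)]
    apply le_of_eq; congr 2
    field_simp
    ring
  have hp := Real.pi_pos
  refine (four_arcs G hG M hM k σ).trans ?_
  rw [← sum_arcs]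
  gcongr
  · exact key _ le_rfl (by linarith)
  · exact key _ (by linarith) (by linarith)
  · exact key _ (by linarith) (by linarith)
  · exact key _ (by linarith) (by linarith)

open Classical in
/-- pointwise density -/
def HH (r η s R : ℝ) (D : Set ℝ) (h : ℝ) : ℝ :=
  if h ^ (r - 1) * s ≤ 1 then
    (if h ∈ D then (s ^ 2)⁻¹ * R * h ^ 2 else (s ^ 4)⁻¹ * R ^ (η / 2) * h ^ (4 - r * η)) else 0

lemma HH_nonneg (r η s R : ℝ) (hR : 0 < R) (D : Set ℝ) (h : ℝ) (hh : 0 ≤ h) : 0 ≤ HH r η s R D h := by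
  unfold HH
  split_ifs <;> positivity

lemma HH_meas (r η s R : ℝ) (D : Set ℝ) (hD : MeasurableSet D) : Measurable (HH r η s R D) := by
  unfold HH
  refine Measurable.ite (measurableSet_le (by fun_prop) measurable_const) (Measurable.ite hD ?_ ?_) measurable_const
  · fun_prop
  · fun_prop

lemma integrable_of_hint (r : ℝ) (hr : 1 ≤ r) (F : ℝ → ℂ) (hF : Measurable F)
    (hint : ∫⁻ φ, ENNReal.ofReal (‖F φ‖ ^ r) ∂nu ≤ 1) : Integrable F nu := by
  refine ⟨hF.aestronglyMeasurable, ?_⟩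
  unfold HasFiniteIntegral
  calc ∫⁻ φ, ‖F φ‖ₑ ∂nu ≤ ∫⁻ φ, 1 + ENNReal.ofReal (‖F φ‖ ^ r) ∂nu := by
        refine lintegral_mono fun φ => ?_
        rw [← ofReal_norm, ← ENNReal.ofReal_one, ← ENNReal.ofReal_add (by norm_num) (by positivity)]
        apply ENNReal.ofReal_le_ofReal
        have h0 := norm_nonneg (F φ)
        rcases le_total ‖F φ‖ 1 with h | h
        · have : 0 ≤ ‖F φ‖ ^ r := by positivity
          linarith
        · have := Real.rpow_le_rpow_of_exponent_le h hr
          rw [Real.rpow_one] at this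
          linarith
    _ = nu univ + ∫⁻ φ, ENNReal.ofReal (‖F φ‖ ^ r) ∂nu := by
        rw [lintegral_add_left measurable_const, lintegral_const, one_mul]
    _ < ∞ := ENNReal.add_lt_top.2 ⟨measure_lt_top _ _, hint.trans_lt ENNReal.one_lt_top⟩

lemma EF_add (F G : ℝ → ℂ) (hF : Integrable F nu) (hG : Integrable G nu) (p : ℝ × ℝ) :
    EF (fun φ => F φ + G φ) p = EF F p + EF G p := by
  unfold EF
  rw [← integral_add (integrable_mul_ph _ _ hF _) (integrable_mul_ph _ _ hG _)]
  congr 1; ext φ; ring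

lemma EF_norm_le (F : ℝ → ℂ) (p : ℝ × ℝ) : ‖EF F p‖ₑ ≤ ∫⁻ φ, ‖F φ‖ₑ ∂nu := by
  unfold EF
  refine (enorm_integral_le_lintegral_enorm _).trans (lintegral_mono fun φ => ?_)
  rw [enorm_mul, ← ofReal_norm (ph _ _ _ _), norm_ph]
  simp

lemma Rgamma_lt (γ t : ℝ) (F : ℝ → ℂ) (p : ℝ × ℝ) (h : t < ‖Rgamma γ F p.1 p.2‖) :
    2 * π * (t * (1 + |p.1| + |p.2|) ^ γ) < ‖EF F p‖ := by
  have hρ : 0 < 1 + |p.1| + |p.2| := by positivity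
  unfold Rgamma at h
  rw [Rext_eq, norm_mul, norm_mul, Complex.norm_real, Complex.norm_real, Real.norm_of_nonneg (by positivity),
    Real.norm_of_nonneg (by positivity), Real.rpow_neg hρ.le, ← div_eq_mul_inv, lt_div_iff₀ (by positivity)] at h
  have := mul_lt_mul_of_pos_left h (show 0 < 2 * π by positivity)
  calc _ < _ := this
    _ = _ := by field_simp

lemma level_sub (γ r : ℝ) (hr : 1 < r) (hγ : 0 < γ) (F : ℝ → ℂ) (hF : Measurable F)
    (hint : ∫⁻ φ, ENNReal.ofReal (‖F φ‖ ^ r) ∂nu ≤ 1) (t : ℝ) (ht : 0 < t) (k : ℕ) (s : ℝ) (hs : s = t * (2 ^ k) ^ γ)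
    (S1 S2 : Set ℝ) (hS1 : MeasurableSet S1) (hS2 : MeasurableSet S2)
    (hS : ∀ φ, ‖F φ‖ ^ (r - 1) * s ≤ 1 → φ ∈ S1 ∪ S2) (hd : Disjoint S1 S2)
    (hSS : ∀ φ ∈ S1 ∪ S2, ‖F φ‖ ^ (r - 1) * s ≤ 1) :
    Ak k ∩ {p | t < ‖Rgamma γ F p.1 p.2‖} ⊆
      (Ak k ∩ {p | s < ‖EF (S1.indicator F) p‖}) ∪ (Ak k ∩ {p | s < ‖EF (S2.indicator F) p‖}) := by
  rintro p ⟨hk, hp⟩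
  have hs0 : 0 < s := by rw [hs]; positivity
  have hFi := integrable_of_hint r hr.le F hF hint
  have h1 : 2 * π * s < ‖EF F p‖ := by
    refine lt_of_le_of_lt ?_ (Rgamma_lt γ t F p hp)
    rw [hs]
    have := hk.1
    gcongr
  have hspl : F = fun φ => ((S1 ∪ S2)ᶜ.indicator F) φ + (S1.indicator F φ + S2.indicator F φ) := by
    ext φ
    have : (S1 ∪ S2).indicator F φ = S1.indicator F φ + S2.indicator F φ := congrFun (indicator_union_of_disjoint hd F) φ
    rw [← this, indicator_compl_add_self_apply]
  have hb : ‖EF ((S1 ∪ S2)ᶜ.indicator F) p‖ ≤ s := by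
    rw [← ENNReal.ofReal_le_ofReal_iff hs0.le, ofReal_norm]
    refine (EF_norm_le _ p).trans ?_
    calc _ ≤ ∫⁻ φ, ENNReal.ofReal s * ENNReal.ofReal (‖F φ‖ ^ r) ∂nu := by
          refine lintegral_mono fun φ => ?_
          by_cases hφ : φ ∈ (S1 ∪ S2)ᶜ
          · rw [indicator_of_mem hφ, ← ENNReal.ofReal_mul hs0.le, ← ofReal_norm]
            apply ENNReal.ofReal_le_ofReal
            have h3 : 1 < ‖F φ‖ ^ (r - 1) * s := by
              by_contra hc
              exact hφ (hS φ (not_lt.1 hc))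
            rcases (norm_nonneg (F φ)).eq_or_lt with h0 | h0
            · rw [← h0]; positivity
            · have e : ‖F φ‖ ^ r = ‖F φ‖ ^ (r - 1) * ‖F φ‖ := by
                rw [← Real.rpow_add_one h0.ne']; congr 1; ring
              rw [e]; nlinarith
          · rw [indicator_of_notMem hφ, enorm_zero]
            exact zero_le
      _ = ENNReal.ofReal s * ∫⁻ φ, ENNReal.ofReal (‖F φ‖ ^ r) ∂nu := lintegral_const_mul' _ _ ENNReal.ofReal_ne_top
      _ ≤ ENNReal.ofReal s * 1 := by gcongr
      _ = _ := mul_one _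
  have hE : EF F p = EF ((S1 ∪ S2)ᶜ.indicator F) p + (EF (S1.indicator F) p + EF (S2.indicator F) p) := by
    conv_lhs => rw [hspl]
    rw [EF_add _ (fun φ => S1.indicator F φ + S2.indicator F φ) (hFi.indicator (hS1.union hS2).compl) ((hFi.indicator hS1).add (hFi.indicator hS2)),
      EF_add _ _ (hFi.indicator hS1) (hFi.indicator hS2)]
  simp only [mem_union, mem_inter_iff, hk, true_and]
  by_contra hc
  simp only [not_or] at hc
  have c1 : ‖EF (S1.indicator F) p‖ ≤ s := not_lt.1 hc.1
  have c2 : ‖EF (S2.indicator F) p‖ ≤ s := not_lt.1 hc.2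
  rw [hE] at h1
  have e1 := norm_add_le (EF ((S1 ∪ S2)ᶜ.indicator F) p) (EF (S1.indicator F) p + EF (S2.indicator F) p)
  have e2 := norm_add_le (EF (S1.indicator F) p) (EF (S2.indicator F) p)
  have := Real.pi_gt_three
  nlinarith

lemma level_split (η r γ : ℝ) (hη : 0 < η) (hη1 : η < 1) (hrη : r * η ≤ 2) (hr : 1 < r) (hγ : 0 < γ) :
    ∃ C : ℝ, 0 < C ∧ ∀ F : ℝ → ℂ, Measurable F → ∫⁻ φ, ENNReal.ofReal (‖F φ‖ ^ r) ∂nu ≤ 1 →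
    ∀ t : ℝ, 0 < t → ∀ (k : ℕ) (D : Set ℝ), MeasurableSet D →
    volume (Ak k ∩ {p | t < ‖Rgamma γ F p.1 p.2‖}) ≤
      ENNReal.ofReal C * ∫⁻ φ, ENNReal.ofReal (HH r η (t * (2 ^ k) ^ γ) (2 ^ k) D ‖F φ‖) ∂nu := by
  obtain ⟨C2, hC2, H2⟩ := core2
  obtain ⟨C4, hC4, H4⟩ := core4 η r hη hη1 hrη
  refine ⟨C2 + C4, by positivity, ?_⟩
  intro F hF hint t ht k D hD
  obtain ⟨s, hs⟩ : ∃ s, s = t * ((2:ℝ) ^ k) ^ γ := ⟨_, rfl⟩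
  have hs0 : 0 < s := by rw [hs]; positivity
  rw [← hs]
  have hNB : MeasurableSet {φ | ‖F φ‖ ^ (r - 1) * s ≤ 1} :=
    measurableSet_le ((hF.norm.pow_const (r - 1)).mul_const s) measurable_const
  have hDm : MeasurableSet {φ | ‖F φ‖ ∈ D} := hF.norm hD
  obtain ⟨S1, hS1⟩ : ∃ S1, S1 = {φ | ‖F φ‖ ^ (r - 1) * s ≤ 1} ∩ {φ | ‖F φ‖ ∈ D} := ⟨_, rfl⟩
  obtain ⟨S2, hS2⟩ : ∃ S2, S2 = {φ | ‖F φ‖ ^ (r - 1) * s ≤ 1} ∩ {φ | ‖F φ‖ ∈ D}ᶜ := ⟨_, rfl⟩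
  have hS1m : MeasurableSet S1 := hS1 ▸ hNB.inter hDm
  have hS2m : MeasurableSet S2 := hS2 ▸ hNB.inter hDm.compl
  have hU : S1 ∪ S2 = {φ | ‖F φ‖ ^ (r - 1) * s ≤ 1} := by
    rw [hS1, hS2, inter_union_compl]
  have hsub := level_sub γ r hr hγ F hF hint t ht k s hs S1 S2 hS1m hS2m (by rw [hU]; exact fun φ h => h)
    (by rw [hS1, hS2]; exact disjoint_left.2 fun x hx hy => hy.2 hx.2) (by rw [hU]; exact fun φ h => h)
  have hbd : ∀ S : Set ℝ, S ⊆ {φ | ‖F φ‖ ^ (r - 1) * s ≤ 1} → ∀ φ, ‖S.indicator F φ‖ ≤ (s⁻¹) ^ (r - 1)⁻¹ := by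
    intro S hSS φ
    have hr1 : 0 < r - 1 := by linarith
    by_cases hφ : φ ∈ S
    · rw [indicator_of_mem hφ]
      have h3 : ‖F φ‖ ^ (r - 1) * s ≤ 1 := hSS hφ
      rw [Real.le_rpow_inv_iff_of_pos (norm_nonneg _) (by positivity) hr1]
      rwa [← one_div, le_div_iff₀ hs0]
    · rw [indicator_of_notMem hφ, norm_zero]; positivity
  have hB1 := hbd S1 (hS1 ▸ inter_subset_left)
  have hB2 := hbd S2 (hS2 ▸ inter_subset_left)
  have k1 := H2 _ (hF.indicator hS1m) _ hB1 k s hs0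
  have hint2 : ∫⁻ φ, ENNReal.ofReal (‖S2.indicator F φ‖ ^ r) ∂nu ≤ 1 := by
    refine le_trans (lintegral_mono fun φ => ?_) hint
    apply ENNReal.ofReal_le_ofReal
    exact Real.rpow_le_rpow (norm_nonneg _) (norm_indicator_le_norm_self _ _) (by linarith)
  have k2 := H4 _ (hF.indicator hS2m) _ hB2 hint2 k s hs0
  refine (measure_mono hsub).trans ((measure_union_le _ _).trans ((add_le_add k1 k2).trans ?_))
  rw [← lintegral_const_mul' _ _ ENNReal.ofReal_ne_top, ← lintegral_const_mul' _ _ ENNReal.ofReal_ne_top,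
    ← lintegral_const_mul' _ _ ENNReal.ofReal_ne_top, ← lintegral_add_left]
  · refine lintegral_mono fun φ => ?_
    rw [enorm_sq_ofReal, ← ENNReal.ofReal_mul (by positivity), ← ENNReal.ofReal_mul (by positivity),
      ← ENNReal.ofReal_mul (by positivity), ← ENNReal.ofReal_add (by positivity) (by positivity)]
    apply ENNReal.ofReal_le_ofReal
    have he : 4 - r * η ≠ 0 := by linarith
    have hh := norm_nonneg (F φ)
    by_cases hA : ‖F φ‖ ^ (r - 1) * s ≤ 1
    · by_cases hdd : ‖F φ‖ ∈ D
      · rw [indicator_of_mem (show φ ∈ S1 from hS1 ▸ ⟨hA, hdd⟩), indicator_of_notMem (show φ ∉ S2 from hS2 ▸ fun h => h.2 hdd),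
          norm_zero, Real.zero_rpow he, HH, if_pos hA, if_pos hdd]
        have : 0 ≤ (s ^ 2)⁻¹ * 2 ^ k * ‖F φ‖ ^ 2 := by positivity
        nlinarith
      · rw [indicator_of_mem (show φ ∈ S2 from hS2 ▸ ⟨hA, hdd⟩), indicator_of_notMem (show φ ∉ S1 from hS1 ▸ fun h => hdd h.2),
          norm_zero, HH, if_pos hA, if_neg hdd]
        have : 0 ≤ (s ^ 4)⁻¹ * (2 ^ k) ^ (η / 2) * ‖F φ‖ ^ (4 - r * η) := by positivity
        nlinarith
    · rw [indicator_of_notMem (show φ ∉ S2 from hS2 ▸ fun h => hA h.1), indicator_of_notMem (show φ ∉ S1 from hS1 ▸ fun h => hA h.1),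
          norm_zero, Real.zero_rpow he, HH, if_neg hA]
      simp
  · exact ((hF.indicator hS1m).enorm.pow_const 2).const_mul _

open Classical in
lemma assemble (η r γ : ℝ) (hη : 0 < η) (hη1 : η < 1) (hrη : r * η ≤ 2) (hr : 1 < r) (hγ : 0 < γ) :
    ∃ C : ℝ, 0 < C ∧ ∀ F : ℝ → ℂ, Measurable F → ∫⁻ φ, ENNReal.ofReal (‖F φ‖ ^ r) ∂nu ≤ 1 →
    ∀ t : ℝ, 0 < t → ∀ (K : Set ℕ) (D : ℕ → Set ℝ), (∀ k, MeasurableSet (D k)) → ∀ B : ℝ, 0 ≤ B →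
    (∀ h : ℝ, 0 < h → ∑' k : ℕ, ENNReal.ofReal (if k ∈ K then HH r η (t * (2 ^ k) ^ γ) (2 ^ k) (D k) h else 0)
      ≤ ENNReal.ofReal (B * h ^ r)) →
    volume {p | (∃ k ∈ K, p ∈ Ak k) ∧ t < ‖Rgamma γ F p.1 p.2‖} ≤ ENNReal.ofReal (C * B) := by
  obtain ⟨C, hC, H⟩ := level_split η r γ hη hη1 hrη hr hγ
  refine ⟨C, hC, ?_⟩
  intro F hF hint t ht K D hD B hB hpt
  have hsub : {p : ℝ × ℝ | (∃ k ∈ K, p ∈ Ak k) ∧ t < ‖Rgamma γ F p.1 p.2‖} ⊆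
      ⋃ k : ℕ, (if k ∈ K then Ak k ∩ {p | t < ‖Rgamma γ F p.1 p.2‖} else ∅) := by
    rintro p ⟨⟨k, hk, hp⟩, h⟩
    refine mem_iUnion.2 ⟨k, ?_⟩
    rw [if_pos hk]; exact ⟨hp, h⟩
  refine (measure_mono hsub).trans ((measure_iUnion_le _).trans ?_)
  have hterm : ∀ k : ℕ, volume (if k ∈ K then Ak k ∩ {p | t < ‖Rgamma γ F p.1 p.2‖} else ∅) ≤
      ENNReal.ofReal C * ∫⁻ φ, ENNReal.ofReal (if k ∈ K then HH r η (t * (2 ^ k) ^ γ) (2 ^ k) (D k) ‖F φ‖ else 0) ∂nu := by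
    intro k
    split_ifs with hk
    · exact H F hF hint t ht k (D k) (hD k)
    · simp
  refine (ENNReal.tsum_le_tsum hterm).trans ?_
  rw [ENNReal.tsum_mul_left, ← lintegral_tsum]
  · rw [ENNReal.ofReal_mul hC.le]
    gcongr
    calc _ ≤ ∫⁻ φ, ENNReal.ofReal B * ENNReal.ofReal (‖F φ‖ ^ r) ∂nu := by
          refine lintegral_mono fun φ => ?_
          rcases (norm_nonneg (F φ)).eq_or_lt with h0 | h0
          · have : ∀ k : ℕ, ENNReal.ofReal (if k ∈ K then HH r η (t * (2 ^ k) ^ γ) (2 ^ k) (D k) ‖F φ‖ else 0) = 0 := by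
              intro k
              have he : 4 - r * η ≠ 0 := by linarith
              rw [← h0, HH]
              rw [Real.zero_rpow he]
              simp
            simp only [this, tsum_zero]
            exact zero_le
          · rw [← ENNReal.ofReal_mul hB]
            exact hpt _ h0
      _ = ENNReal.ofReal B * ∫⁻ φ, ENNReal.ofReal (‖F φ‖ ^ r) ∂nu := lintegral_const_mul' _ _ ENNReal.ofReal_ne_top
      _ ≤ ENNReal.ofReal B * 1 := by gcongr
      _ = _ := mul_one _
  · intro k
    apply Measurable.aemeasurable
    apply Measurable.ennreal_ofReal
    split_ifs
    · exact (HH_meas _ _ _ _ _ (hD k)).comp hF.norm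
    · exact measurable_const

lemma tele (f g : ℕ → ℝ) (hf : ∀ k, 0 ≤ f k) (h : ∀ k, f k ≤ g (k + 1) - g k) (B : ℝ) (h0 : 0 ≤ g 0) (hB : ∀ k, g k ≤ B) :
    ∑' k, ENNReal.ofReal (f k) ≤ ENNReal.ofReal B := by
  refine ENNReal.tsum_le_of_sum_range_le fun n => ?_
  rw [← ENNReal.ofReal_sum_of_nonneg fun k _ => hf k]
  apply ENNReal.ofReal_le_ofReal
  have := Finset.sum_le_sum (s := Finset.range n) fun k _ => h k
  rw [Finset.sum_range_sub] at this
  linarith [hB n]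

lemma geo1 (x : ℝ) (hx : 1 < x) (Λ : ℝ) (hΛ : 0 < Λ) :
    ∑' k : ℕ, ENNReal.ofReal (if x ^ k ≤ Λ then x ^ k else 0) ≤ ENNReal.ofReal (x / (x - 1) * Λ) := by
  have h1 : 0 < x - 1 := by linarith
  refine tele _ (fun k => min (x ^ k) (x * Λ) / (x - 1)) (fun k => ?_) (fun k => ?_) _ ?_ (fun k => ?_)
  · split_ifs <;> positivity
  · rw [← sub_div, le_div_iff₀ h1]
    split_ifs with h
    · have h2 : x ^ (k + 1) ≤ x * Λ := by rw [pow_succ, mul_comm]; gcongr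
      have h3 : x ^ k ≤ x * Λ := h.trans (by nlinarith)
      rw [min_eq_left h2, min_eq_left h3, pow_succ]
      apply le_of_eq; ring
    · rw [zero_mul, sub_nonneg]
      have : x ^ k ≤ x ^ (k + 1) := pow_le_pow_right₀ hx.le (by simp)
      exact min_le_min_right _ this
  · apply div_nonneg _ h1.le
    apply le_min <;> positivity
  · rw [div_mul_eq_mul_div]
    gcongr
    exact min_le_right _ _

lemma geo2 (x : ℝ) (hx : 1 < x) (Λ : ℝ) (hΛ : 0 < Λ) :
    ∑' k : ℕ, ENNReal.ofReal (if Λ ≤ x ^ k then (x ^ k)⁻¹ else 0) ≤ ENNReal.ofReal (x / (x - 1) * Λ⁻¹) := by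
  have h1 : 0 < x - 1 := by linarith
  refine tele _ (fun k => x / (x - 1) * (Λ⁻¹ - (max (x ^ k) Λ)⁻¹)) (fun k => ?_) (fun k => ?_) _ ?_ (fun k => ?_)
  · split_ifs <;> positivity
  · have hm : x ^ k ≤ x ^ (k + 1) := pow_le_pow_right₀ hx.le (by simp)
    split_ifs with h
    · rw [max_eq_left h, max_eq_left (h.trans hm), pow_succ]
      apply le_of_eq
      have : x ^ k ≠ 0 := by positivity
      field_simp
      ring
    · have : (max (x ^ (k + 1)) Λ)⁻¹ ≤ (max (x ^ k) Λ)⁻¹ := by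
        apply inv_anti₀
        · positivity
        · exact max_le_max_right _ hm
      rw [← mul_sub]
      apply mul_nonneg (by positivity)
      linarith
  · apply mul_nonneg (by positivity)
    rw [sub_nonneg]
    exact inv_anti₀ hΛ (le_max_right _ _)
  · gcongr
    have : 0 < (max (x ^ k) Λ)⁻¹ := by positivity
    linarith

/-- dyadic logarithm -/
def rk (k : ℕ) : ℝ := k * Real.log 2

lemma two_pow_rk (k : ℕ) : (2:ℝ) ^ k = Real.exp (rk k) := by
  rw [rk, Real.exp_nat_mul, Real.exp_log (by norm_num)]

lemma exp_rk (c : ℝ) (k : ℕ) : Real.exp (c * rk k) = Real.exp (c * Real.log 2) ^ k := by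
  rw [rk, ← Real.exp_nat_mul]; congr 1; ring

lemma one_lt_xc (c : ℝ) (hc : 0 < c) : 1 < Real.exp (c * Real.log 2) :=
  Real.one_lt_exp_iff.2 (mul_pos hc (Real.log_pos (by norm_num)))

lemma G1 (c : ℝ) (hc : 0 < c) : ∃ C : ℝ, 0 < C ∧ ∀ L : ℝ,
    ∑' k : ℕ, ENNReal.ofReal (if c * rk k ≤ L then Real.exp (c * rk k) else 0) ≤ ENNReal.ofReal (C * Real.exp L) := by
  have hx := one_lt_xc c hc
  refine ⟨_, div_pos (by positivity : 0 < Real.exp (c * Real.log 2)) (sub_pos.2 hx), fun L => ?_⟩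
  refine le_trans (le_of_eq ?_) (geo1 _ hx (Real.exp L) (Real.exp_pos L))
  congr 1; ext k
  rw [← exp_rk]
  simp only [Real.exp_le_exp]

lemma G2 (c : ℝ) (hc : 0 < c) : ∃ C : ℝ, 0 < C ∧ ∀ L : ℝ,
    ∑' k : ℕ, ENNReal.ofReal (if L ≤ c * rk k then Real.exp (-(c * rk k)) else 0) ≤ ENNReal.ofReal (C * Real.exp (-L)) := by
  have hx := one_lt_xc c hc
  refine ⟨_, div_pos (by positivity : 0 < Real.exp (c * Real.log 2)) (sub_pos.2 hx), fun L => ?_⟩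
  rw [Real.exp_neg]
  refine le_trans (le_of_eq ?_) (geo2 _ hx (Real.exp L) (Real.exp_pos L))
  congr 1; ext k
  rw [← exp_rk]
  simp only [Real.exp_le_exp, Real.exp_neg]

lemma mid_exp (γ τ ρ H : ℝ) : ((Real.exp τ * Real.exp ρ ^ γ) ^ 2)⁻¹ * Real.exp ρ * Real.exp H ^ 2 =
    Real.exp (-2 * τ + (1 - 2 * γ) * ρ + 2 * H) := by
  rw [← Real.exp_mul, ← Real.exp_add, ← Real.exp_nat_mul, ← Real.exp_nat_mul, ← Real.exp_neg, ← Real.exp_add, ← Real.exp_add]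
  congr 1; push_cast; ring

lemma small_exp (γ η e τ ρ H : ℝ) : ((Real.exp τ * Real.exp ρ ^ γ) ^ 4)⁻¹ * Real.exp ρ ^ (η / 2) * Real.exp H ^ e =
    Real.exp (-4 * τ + (η / 2 - 4 * γ) * ρ + e * H) := by
  rw [← Real.exp_mul, ← Real.exp_mul, ← Real.exp_mul, ← Real.exp_add, ← Real.exp_nat_mul, ← Real.exp_neg, ← Real.exp_add, ← Real.exp_add]
  congr 1; push_cast; ring

lemma big_exp (γ r τ ρ H : ℝ) : Real.exp H ^ (r - 1) * (Real.exp τ * Real.exp ρ ^ γ) ≤ 1 ↔ (r - 1) * H + τ + γ * ρ ≤ 0 := by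
  rw [← Real.exp_mul, ← Real.exp_mul, ← Real.exp_add, ← Real.exp_add, Real.exp_le_one_iff]
  constructor <;> intro h <;> linarith

/-- weak bound -/
def WB (γ q r : ℝ) : Prop := ∃ C : ℝ, 0 < C ∧ ∀ F : ℝ → ℂ, Measurable F →
  ∫⁻ φ, ENNReal.ofReal (‖F φ‖ ^ r) ∂nu ≤ 1 → ∀ t : ℝ, 0 < t →
  volume {p : ℝ × ℝ | t < ‖Rgamma γ F p.1 p.2‖} ≤ ENNReal.ofReal (C * t ^ (-q))

lemma exists_Ak (p : ℝ × ℝ) : ∃ k, p ∈ Ak k := by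
  obtain ⟨n, h1, h2⟩ := exists_nat_pow_near (x := 1 + |p.1| + |p.2|) (y := 2)
    (by linarith [abs_nonneg p.1, abs_nonneg p.2]) (by norm_num)
  exact ⟨n, h1, h2⟩

lemma vol_rho (X : ℝ) (hX : 0 ≤ X) : volume {p : ℝ × ℝ | 1 + |p.1| + |p.2| < X} ≤ ENNReal.ofReal (4 * X ^ 2) := by
  have : {p : ℝ × ℝ | 1 + |p.1| + |p.2| < X} ⊆ Ioo (-X) X ×ˢ Ioo (-X) X := by
    intro p hp
    have hp' : 1 + |p.1| + |p.2| < X := hp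
    have a1 := abs_nonneg p.1
    have a2 := abs_nonneg p.2
    exact ⟨abs_lt.1 (by linarith), abs_lt.1 (by linarith)⟩
  refine (measure_mono this).trans ?_
  rw [Measure.volume_eq_prod, Measure.prod_prod, Real.volume_Ioo, ← ENNReal.ofReal_mul (by linarith)]
  apply le_of_eq; congr 1; ring

/-- case A0 -/
lemma caseA0 (γ : ℝ) (hγ : 0 < γ) : WB γ (2 / γ) 1 := by
  refine ⟨4, by norm_num, ?_⟩
  intro F hF hint t ht
  have hsub : {p : ℝ × ℝ | t < ‖Rgamma γ F p.1 p.2‖} ⊆ {p : ℝ × ℝ | 1 + |p.1| + |p.2| < t ^ (-1 / γ)} := by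
    intro p hp
    have h1 := Rgamma_lt γ t F p hp
    have h2 : ‖EF F p‖ ≤ 1 := by
      rw [← ENNReal.ofReal_le_ofReal_iff (by norm_num), ofReal_norm, ENNReal.ofReal_one]
      refine (EF_norm_le F p).trans (le_trans (le_of_eq ?_) hint)
      congr 1; ext φ; rw [Real.rpow_one, ofReal_norm]
    have hρ : 0 < 1 + |p.1| + |p.2| := by positivity
    have h3 : t * (1 + |p.1| + |p.2|) ^ γ < 1 := by
      have : 0 < t * (1 + |p.1| + |p.2|) ^ γ := by positivity
      nlinarith [Real.pi_gt_three]
    have h4 : (1 + |p.1| + |p.2|) ^ γ < t⁻¹ := by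
      rw [← one_div, lt_div_iff₀ ht]; linarith
    show 1 + |p.1| + |p.2| < t ^ (-1 / γ)
    rw [show -1 / γ = (-1) * γ⁻¹ by ring, Real.rpow_mul ht.le, Real.rpow_neg_one,
      Real.lt_rpow_inv_iff_of_pos hρ.le (by positivity) hγ]
    exact h4
  refine (measure_mono hsub).trans ((vol_rho _ (by positivity)).trans (le_of_eq ?_))
  congr 2
  rw [← Real.rpow_natCast, ← Real.rpow_mul ht.le]
  congr 1; push_cast; ring

lemma ofReal_ite_le (P Q : Prop) [Decidable P] [Decidable Q] (X E Y : ℝ) (hE : 0 ≤ E) (hY : 0 ≤ Y) (h : P → Q ∧ X ≤ E * Y) :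
    ENNReal.ofReal (if P then X else 0) ≤ ENNReal.ofReal E * ENNReal.ofReal (if Q then Y else 0) := by
  rw [← ENNReal.ofReal_mul hE]
  apply ENNReal.ofReal_le_ofReal
  split_ifs with h1 h2 h2
  · exact (h h1).2
  · exact absurd (h h1).1 h2
  · positivity
  · simp

lemma HH_univ_exp (r η γ τ ρ H : ℝ) : HH r η (Real.exp τ * Real.exp ρ ^ γ) (Real.exp ρ) univ (Real.exp H) =
    if (r - 1) * H + τ + γ * ρ ≤ 0 then Real.exp (-2 * τ + (1 - 2 * γ) * ρ + 2 * H) else 0 := by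
  unfold HH
  rw [if_pos (mem_univ _), mid_exp]
  by_cases h : (r - 1) * H + τ + γ * ρ ≤ 0
  · rw [if_pos h, if_pos ((big_exp _ _ _ _ _).2 h)]
  · rw [if_neg h, if_neg (mt (big_exp _ _ _ _ _).1 h)]

lemma caseA (γ b r : ℝ) (hb : 0 < b) (hb2 : b ≤ 1 / 2) (hbγ : b < γ) (hr : r * (1 - b) = 1) :
    WB γ (2 / (γ + b)) r := by
  have hγ : 0 < γ := hb.trans hbγ
  have hr1 : 1 < r := by nlinarith
  have hr2 : r ≤ 2 := by nlinarith
  obtain ⟨C, hC, HA⟩ := assemble (1 / 2) r γ (by norm_num) (by norm_num) (by linarith) hr1 hγ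
  have hc : 0 < γ / b - 1 := by rw [sub_pos, one_lt_div hb]; exact hbγ
  obtain ⟨C', hC', HG⟩ := G2 (γ / b - 1) hc
  refine ⟨C * C' + 16, by positivity, ?_⟩
  intro F hF hint t ht
  obtain ⟨τ, rfl⟩ : ∃ τ, t = Real.exp τ := ⟨Real.log t, (Real.exp_log ht).symm⟩
  obtain ⟨L, hL⟩ : ∃ L, L = -τ / (γ + b) := ⟨_, rfl⟩
  have htq : Real.exp τ ^ (-(2 / (γ + b))) = Real.exp L ^ 2 := by
    rw [← Real.exp_mul, ← Real.exp_nat_mul, hL]; congr 1; push_cast; ring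
  have hA := HA F hF hint (Real.exp τ) (Real.exp_pos _) {k | (γ / b - 1) * L ≤ (γ / b - 1) * rk k} (fun _ => univ)
    (fun _ => MeasurableSet.univ) (C' * Real.exp L ^ 2) (by positivity) (by
    intro h hh
    obtain ⟨H, rfl⟩ : ∃ H, h = Real.exp H := ⟨Real.log h, (Real.exp_log hh).symm⟩
    have hterm : ∀ k : ℕ, ENNReal.ofReal (if k ∈ {k | (γ / b - 1) * L ≤ (γ / b - 1) * rk k} then
        HH r (1 / 2) (Real.exp τ * (2 ^ k) ^ γ) (2 ^ k) univ (Real.exp H) else 0) ≤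
        ENNReal.ofReal (Real.exp (-τ / b + r * H)) *
          ENNReal.ofReal (if (γ / b - 1) * L ≤ (γ / b - 1) * rk k then Real.exp (-((γ / b - 1) * rk k)) else 0) := by
      intro k
      apply ofReal_ite_le _ _ _ _ _ (by positivity) (by positivity)
      intro hk
      refine ⟨hk, ?_⟩
      rw [two_pow_rk, HH_univ_exp]
      split_ifs with hbig
      · rw [← Real.exp_add]
        apply Real.exp_le_exp.2
        have hm : 0 ≤ 1 / b - 2 := by rw [sub_nonneg, le_div_iff₀ hb]; linarith
        have h1 := mul_nonneg hm (neg_nonneg.2 hbig)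
        have h2 : (1 / b - 2) * (r - 1) = 2 - r := by
          field_simp
          linarith
        have h3 : -τ / b = - (1 / b * τ) := by ring
        have h4 : γ / b = 1 / b * γ := by ring
        rw [h3, h4]
        have h5 : (1 / b - 2) * -((r - 1) * H + τ + γ * rk k) = - ((2 - r) * H + (1 / b - 2) * (τ + γ * rk k)) := by
          rw [← h2]; ring
        rw [h5] at h1
        linarith
      · positivity
    refine (ENNReal.tsum_le_tsum hterm).trans ?_
    rw [ENNReal.tsum_mul_left]
    refine (mul_le_mul_right (HG _) _).trans (le_of_eq ?_)
    rw [← ENNReal.ofReal_mul (by positivity)]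
    congr 1
    rw [mul_left_comm, ← Real.exp_add, ← Real.exp_nat_mul, ← Real.exp_mul, mul_assoc, ← Real.exp_add]
    congr 2
    rw [hL]
    have : γ + b ≠ 0 := by positivity
    push_cast
    field_simp
    ring)
  have hsub : {p : ℝ × ℝ | Real.exp τ < ‖Rgamma γ F p.1 p.2‖} ⊆
      {p | (∃ k ∈ {k | (γ / b - 1) * L ≤ (γ / b - 1) * rk k}, p ∈ Ak k) ∧ Real.exp τ < ‖Rgamma γ F p.1 p.2‖} ∪
      {p | 1 + |p.1| + |p.2| < 2 * Real.exp L} := by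
    intro p hp
    obtain ⟨k, hk⟩ := exists_Ak p
    by_cases hkK : (γ / b - 1) * L ≤ (γ / b - 1) * rk k
    · exact Or.inl ⟨⟨k, hkK, hk⟩, hp⟩
    · right
      have h1 : rk k < L := lt_of_mul_lt_mul_left (not_le.1 hkK) hc.le
      have h2 := hk.2
      rw [pow_succ, two_pow_rk] at h2
      have h3 := Real.exp_lt_exp.2 h1
      show 1 + |p.1| + |p.2| < 2 * Real.exp L
      linarith
  refine (measure_mono hsub).trans ((measure_union_le _ _).trans ((add_le_add hA (vol_rho _ (by positivity))).trans ?_))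
  rw [← ENNReal.ofReal_add (by positivity) (by positivity), htq]
  apply le_of_eq; congr 1; ring

lemma all_K (γ t : ℝ) (F : ℝ → ℂ) : {p : ℝ × ℝ | t < ‖Rgamma γ F p.1 p.2‖} ⊆
    {p | (∃ k ∈ (univ : Set ℕ), p ∈ Ak k) ∧ t < ‖Rgamma γ F p.1 p.2‖} := by
  intro p hp
  obtain ⟨k, hk⟩ := exists_Ak p
  exact ⟨⟨k, mem_univ _, hk⟩, hp⟩

lemma caseB (γ r : ℝ) (hγ : 0 < γ) (hγ2 : γ < 1 / 2) (hr : r * (1 - γ) = 1) :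
    WB γ (1 / γ) r := by
  have hr1 : 1 < r := by nlinarith
  have hr2 : r ≤ 2 := by nlinarith
  obtain ⟨C, hC, HA⟩ := assemble (1 / 2) r γ (by norm_num) (by norm_num) (by linarith) hr1 hγ
  have hc : 0 < 1 - 2 * γ := by linarith
  obtain ⟨C', hC', HG⟩ := G1 (1 - 2 * γ) hc
  refine ⟨C * C', by positivity, ?_⟩
  intro F hF hint t ht
  obtain ⟨τ, rfl⟩ : ∃ τ, t = Real.exp τ := ⟨Real.log t, (Real.exp_log ht).symm⟩
  have hA := HA F hF hint (Real.exp τ) (Real.exp_pos _) univ (fun _ => univ)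
    (fun _ => MeasurableSet.univ) (C' * Real.exp τ ^ (-(1 / γ))) (by positivity) (by
    intro h hh
    obtain ⟨H, rfl⟩ : ∃ H, h = Real.exp H := ⟨Real.log h, (Real.exp_log hh).symm⟩
    have hterm : ∀ k : ℕ, ENNReal.ofReal (
        HH r (1 / 2) (Real.exp τ * (2 ^ k) ^ γ) (2 ^ k) univ (Real.exp H)) ≤
        ENNReal.ofReal (Real.exp (-2 * τ + 2 * H)) *
          ENNReal.ofReal (if (1 - 2 * γ) * rk k ≤ (2 - 1 / γ) * τ + (r - 2) * H then Real.exp ((1 - 2 * γ) * rk k) else 0) := by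
      intro k
      rw [two_pow_rk, HH_univ_exp]
      apply ofReal_ite_le _ _ _ _ _ (by positivity) (by positivity)
      intro hbig
      constructor
      · have hm : 0 ≤ 1 / γ - 2 := by rw [sub_nonneg, le_div_iff₀ hγ]; linarith
        have h1 := mul_nonneg hm (neg_nonneg.2 hbig)
        have h2 : (1 / γ - 2) * (r - 1) = 2 - r := by
          field_simp
          linarith
        have h5 : (1 / γ - 2) * -((r - 1) * H + τ + γ * rk k) = - ((2 - r) * H + (1 / γ - 2) * τ + (1 - 2 * γ) * rk k) := by
          rw [← h2]; field_simp
        rw [h5] at h1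
        linarith
      · rw [← Real.exp_add]
        apply Real.exp_le_exp.2; linarith
    simp only [mem_univ, if_true]
    refine (ENNReal.tsum_le_tsum hterm).trans ?_
    rw [ENNReal.tsum_mul_left]
    refine (mul_le_mul_right (HG _) _).trans (le_of_eq ?_)
    rw [← ENNReal.ofReal_mul (by positivity)]
    congr 1
    rw [mul_left_comm, ← Real.exp_add, ← Real.exp_mul, ← Real.exp_mul, mul_assoc, ← Real.exp_add]
    congr 2
    ring)
  refine (measure_mono (all_K _ _ _)).trans (hA.trans (le_of_eq ?_))
  rw [mul_assoc]

lemma D_exp (γ η r τ ρ H : ℝ) : Real.exp H ∈ {h : ℝ | (Real.exp τ * Real.exp ρ ^ γ) ^ 2 * Real.exp ρ ^ (1 - η / 2) < h ^ (2 - r * η)} ↔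
    2 * τ + (2 * γ + 1 - η / 2) * ρ - (2 - r * η) * H < 0 := by
  rw [mem_ofPred_eq, ← Real.exp_mul, ← Real.exp_mul, ← Real.exp_mul, ← Real.exp_add, ← Real.exp_nat_mul, ← Real.exp_add, Real.exp_lt_exp]
  push_cast
  constructor <;> intro h <;> linarith

lemma HH_D_exp (r η γ τ ρ H : ℝ) : HH r η (Real.exp τ * Real.exp ρ ^ γ) (Real.exp ρ)
      {h : ℝ | (Real.exp τ * Real.exp ρ ^ γ) ^ 2 * Real.exp ρ ^ (1 - η / 2) < h ^ (2 - r * η)} (Real.exp H) =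
    if (r - 1) * H + τ + γ * ρ ≤ 0 then
      (if 2 * τ + (2 * γ + 1 - η / 2) * ρ - (2 - r * η) * H < 0 then Real.exp (-2 * τ + (1 - 2 * γ) * ρ + 2 * H)
      else Real.exp (-4 * τ + (η / 2 - 4 * γ) * ρ + (4 - r * η) * H)) else 0 := by
  unfold HH
  rw [mid_exp, small_exp]
  by_cases h : (r - 1) * H + τ + γ * ρ ≤ 0
  · rw [if_pos h, if_pos ((big_exp _ _ _ _ _).2 h)]
    by_cases h' : 2 * τ + (2 * γ + 1 - η / 2) * ρ - (2 - r * η) * H < 0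
    · rw [if_pos h', if_pos ((D_exp _ _ _ _ _ _).2 h')]
    · rw [if_neg h', if_neg (mt (D_exp _ _ _ _ _ _).1 h')]
  · rw [if_neg h, if_neg (mt (big_exp _ _ _ _ _).1 h)]

lemma caseC_aux (γ b r q η x y : ℝ) (hγ : 0 < γ) (hγ2 : γ < 1 / 2) (hr1 : 1 < r)
    (hη : 0 < η) (hη1 : η < 1) (hrη : r * η ≤ 2) (hx : 0 ≤ x) (hy : 0 ≤ y) (hy1 : y < 1)
    (i1 : q = 2 + x + 2 * y) (i2 : r = 2 - (r - 1) * x + (2 - r * η) * y)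
    (i3 : γ * x + y * (2 * γ + 1 - η / 2) = 1 - 2 * γ) :
    WB γ q r := by
  obtain ⟨C, hC, HA⟩ := assemble η r γ hη hη1 hrη hr1 hγ
  have hc : 0 < 1 - 2 * γ := by linarith
  obtain ⟨C', hC', HG⟩ := G1 (1 - 2 * γ) hc
  have hc2 : 0 < (1 - y) * (2 * γ + 1 - η / 2) := mul_pos (by linarith) (by linarith)
  obtain ⟨C2, hC2, HG2⟩ := G2 _ hc2
  refine ⟨C * (C' + C2), by positivity, ?_⟩
  intro F hF hint t ht
  obtain ⟨τ, rfl⟩ : ∃ τ, t = Real.exp τ := ⟨Real.log t, (Real.exp_log ht).symm⟩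
  have hA := HA F hF hint (Real.exp τ) (Real.exp_pos _) univ
    (fun k => {h : ℝ | (Real.exp τ * ((2:ℝ) ^ k) ^ γ) ^ 2 * ((2:ℝ) ^ k) ^ (1 - η / 2) < h ^ (2 - r * η)})
    (fun _ => measurableSet_lt measurable_const (by fun_prop)) ((C' + C2) * Real.exp τ ^ (-q)) (by positivity) (by
    intro h hh
    obtain ⟨H, rfl⟩ : ∃ H, h = Real.exp H := ⟨Real.log h, (Real.exp_log hh).symm⟩
    have hterm : ∀ k : ℕ, ENNReal.ofReal (
        HH r η (Real.exp τ * (2 ^ k) ^ γ) (2 ^ k) {h : ℝ | (Real.exp τ * ((2:ℝ) ^ k) ^ γ) ^ 2 * ((2:ℝ) ^ k) ^ (1 - η / 2) < h ^ (2 - r * η)} (Real.exp H)) ≤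
        ENNReal.ofReal (Real.exp (-2 * τ + 2 * H)) *
          ENNReal.ofReal (if (1 - 2 * γ) * rk k ≤ (2 - q) * τ + (r - 2) * H then Real.exp ((1 - 2 * γ) * rk k) else 0) +
        ENNReal.ofReal (Real.exp (-(4 + x) * τ + (4 - r * η - (r - 1) * x) * H)) *
          ENNReal.ofReal (if (1 - y) * ((2 - r * η) * H - 2 * τ) ≤ (1 - y) * (2 * γ + 1 - η / 2) * rk k then
            Real.exp (-((1 - y) * (2 * γ + 1 - η / 2) * rk k)) else 0) := by
      intro k
      rw [two_pow_rk, HH_D_exp]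
      by_cases hbig : (r - 1) * H + τ + γ * rk k ≤ 0
      · rw [if_pos hbig]
        have hN := mul_nonneg hx (neg_nonneg.2 hbig)
        by_cases hP : 2 * τ + (2 * γ + 1 - η / 2) * rk k - (2 - r * η) * H < 0
        · rw [if_pos hP]
          refine le_trans ?_ le_self_add
          rw [if_pos, ← ENNReal.ofReal_mul (by positivity), ← Real.exp_add]
          · apply ENNReal.ofReal_le_ofReal; apply Real.exp_le_exp.2; linarith
          · have hP' := mul_nonneg hy (neg_nonneg.2 hP.le)
            have e : (2 - q) * τ + (r - 2) * H - (1 - 2 * γ) * rk k = x * -((r - 1) * H + τ + γ * rk k) +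
                y * -(2 * τ + (2 * γ + 1 - η / 2) * rk k - (2 - r * η) * H) := by
              linear_combination (-τ) * i1 + H * i2 + rk k * i3
            linarith
        · rw [if_neg hP]
          refine le_trans ?_ le_add_self
          rw [if_pos, ← ENNReal.ofReal_mul (by positivity), ← Real.exp_add]
          · apply ENNReal.ofReal_le_ofReal; apply Real.exp_le_exp.2
            have e : (-(4 + x) * τ + (4 - r * η - (r - 1) * x) * H + -((1 - y) * (2 * γ + 1 - η / 2) * rk k)) -
              (-4 * τ + (η / 2 - 4 * γ) * rk k + (4 - r * η) * H) = x * -((r - 1) * H + τ + γ * rk k) := by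
              linear_combination (rk k) * i3
            linarith
          · rw [mul_assoc]
            apply mul_le_mul_of_nonneg_left _ (by linarith)
            linarith [not_lt.1 hP]
      · rw [if_neg hbig]; simp
    simp only [mem_univ, if_true]
    refine (ENNReal.tsum_le_tsum hterm).trans ?_
    rw [ENNReal.tsum_add, ENNReal.tsum_mul_left, ENNReal.tsum_mul_left]
    refine (add_le_add (mul_le_mul_right (HG _) _) (mul_le_mul_right (HG2 _) _)).trans (le_of_eq ?_)
    rw [← ENNReal.ofReal_mul (by positivity), ← ENNReal.ofReal_mul (by positivity), ← ENNReal.ofReal_add (by positivity) (by positivity)]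
    congr 1
    rw [mul_left_comm, ← Real.exp_add, mul_left_comm, ← Real.exp_add, ← Real.exp_mul, ← Real.exp_mul, mul_assoc, ← Real.exp_add, add_mul]
    congr 3
    · ring
    · linear_combination τ * i1 - H * i2)
  refine (measure_mono (all_K _ _ _)).trans (hA.trans (le_of_eq ?_))
  rw [mul_assoc]

lemma caseC (γ b r q : ℝ) (hγ : 0 < γ) (hγ2 : γ < 1 / 2) (hb : γ < b) (hb2 : b < 3 / 4 - γ / 2) (hr : r * (1 - b) = 1)
    (hq : q * (2 * γ + b) = 3) : WB γ q r := by
  have hb1 : 0 < 1 - b := by linarith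
  have hr0 : 0 < r := by
    by_contra h
    nlinarith [not_lt.1 h]
  have hr1 : 1 < r := by nlinarith
  have hq0 : 0 < q := by
    by_contra h
    nlinarith [not_lt.1 h]
  have p1 : 0 < 3 - q * b := by nlinarith
  have p2 : 0 < q * (1 - b) - 1 := by
    have h1 : (q * (1 - b) - 1) * (2 * γ + b) = 3 - 4 * b - 2 * γ := by linear_combination (1 - b) * hq
    have h2 : 0 < 2 * γ + b := by linarith
    by_contra h
    nlinarith [not_lt.1 h]
  have p3 : 0 < q * b - 1 := by nlinarith
  obtain ⟨η, hη, e1, e2, e3, e4⟩ : ∃ η : ℝ, 0 < η ∧ η ≤ 1 / 2 ∧ η ≤ 1 / r ∧ η ≤ (3 - q * b) / 2 ∧ η ≤ (q * (1 - b) - 1) / q := by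
    refine ⟨min (min (1 / 2) (1 / r)) (min ((3 - q * b) / 2) ((q * (1 - b) - 1) / q)), ?_, ?_, ?_, ?_, ?_⟩
    · refine lt_min (lt_min ?_ ?_) (lt_min ?_ ?_) <;> positivity
    · exact (min_le_left _ _).trans (min_le_left _ _)
    · exact (min_le_left _ _).trans (min_le_right _ _)
    · exact (min_le_right _ _).trans (min_le_left _ _)
    · exact (min_le_right _ _).trans (min_le_right _ _)
  rw [le_div_iff₀ hr0] at e2
  rw [le_div_iff₀ hq0] at e4
  have hη2 : 0 < 2 - η := by linarith
  obtain ⟨y, hy⟩ : ∃ y, y = (q * b - 1) / (2 - η) := ⟨_, rfl⟩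
  have hy' : y * (2 - η) = q * b - 1 := by rw [hy]; field_simp
  have hy0 : 0 < y := by rw [hy]; positivity
  have hy1 : y < 1 := by rw [hy, div_lt_one hη2]; linarith
  have hx : 0 ≤ q - 2 - 2 * y := by
    have h1 : (q - 2 - 2 * y) * (2 - η) = 2 * (q * (1 - b) - 1) - (q - 2) * η := by linear_combination -2 * hy'
    by_contra h
    nlinarith [not_le.1 h]
  refine caseC_aux γ b r q η (q - 2 - 2 * y) y hγ hγ2 hr1 hη (by linarith) (by linarith) hx hy0.le hy1 (by ring) ?_ ?_
  · linear_combination q * hr - r * hy'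
  · linear_combination (1 / 2) * hq + (1 / 2) * hy'

lemma EF_le_of_hint (r : ℝ) (hr : 1 ≤ r) (F : ℝ → ℂ)
    (hint : ∫⁻ φ, ENNReal.ofReal (‖F φ‖ ^ r) ∂nu ≤ 1) (p : ℝ × ℝ) : ‖EF F p‖ ≤ 2 * π + 1 := by
  rw [← ENNReal.ofReal_le_ofReal_iff (by positivity), ofReal_norm]
  refine (EF_norm_le F p).trans ?_
  calc ∫⁻ φ, ‖F φ‖ₑ ∂nu ≤ ∫⁻ φ, 1 + ENNReal.ofReal (‖F φ‖ ^ r) ∂nu := by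
        refine lintegral_mono fun φ => ?_
        rw [← ofReal_norm, ← ENNReal.ofReal_one, ← ENNReal.ofReal_add (by norm_num) (by positivity)]
        apply ENNReal.ofReal_le_ofReal
        have h0 := norm_nonneg (F φ)
        rcases le_total ‖F φ‖ 1 with h | h
        · have : 0 ≤ ‖F φ‖ ^ r := by positivity
          linarith
        · have := Real.rpow_le_rpow_of_exponent_le h hr
          rw [Real.rpow_one] at this
          linarith
    _ = nu univ + ∫⁻ φ, ENNReal.ofReal (‖F φ‖ ^ r) ∂nu := by
        rw [lintegral_add_left measurable_const, lintegral_const, one_mul]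
    _ ≤ ENNReal.ofReal (2 * π) + 1 := by
        gcongr
        unfold nu
        rw [Measure.restrict_apply_univ, Real.volume_Ioc, sub_zero]
    _ = _ := by rw [ENNReal.ofReal_add (by positivity) (by norm_num), ENNReal.ofReal_one]

lemma WB_mono (γ q' q r : ℝ) (hγ : 0 < γ) (hr : 1 ≤ r) (hq : q' ≤ q) (h : WB γ q' r) : WB γ q r := by
  obtain ⟨C, hC, H⟩ := h
  refine ⟨C * 2 ^ (q - q'), by positivity, ?_⟩
  intro F hF hint t ht
  by_cases ht2 : t < 2
  · refine (H F hF hint t ht).trans (ENNReal.ofReal_le_ofReal ?_)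
    rw [mul_assoc]
    gcongr
    rw [show -q' = (q - q') + -q by ring, Real.rpow_add ht]
    gcongr
  · have : {p : ℝ × ℝ | t < ‖Rgamma γ F p.1 p.2‖} = ∅ := by
      rw [eq_empty_iff_forall_notMem]
      intro p hp
      have h1 := Rgamma_lt γ t F p hp
      have h2 := EF_le_of_hint r hr F hint p
      have h3 : 1 ≤ (1 + |p.1| + |p.2|) ^ γ :=
        Real.one_le_rpow (by linarith [abs_nonneg p.1, abs_nonneg p.2]) hγ.le
      have h4 := Real.pi_gt_three
      have h5 : 2 * 1 ≤ t * (1 + |p.1| + |p.2|) ^ γ := by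
        apply mul_le_mul (not_lt.1 ht2) h3 (by norm_num) ht.le
      nlinarith
    rw [this, measure_empty]
    exact zero_le

lemma WB_A (γ b : ℝ) (hγ : 0 < γ) (hb : 0 ≤ b) (hb2 : b ≤ 1 / 2) (hbγ : b < γ) : WB γ (2 / (γ + b)) (1 / (1 - b)) := by
  rcases hb.eq_or_lt with h | h
  · rw [← h]
    simpa using caseA0 γ hγ
  · apply caseA γ b _ h hb2 hbγ
    have : 1 - b ≠ 0 := by linarith
    field_simp

lemma WB_C (γ b : ℝ) (hγ : 0 < γ) (hγ2 : γ < 1 / 2) (hb : γ < b) (hb2 : b < 3 / 4 - γ / 2) :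
    WB γ (3 / (2 * γ + b)) (1 / (1 - b)) := by
  have : 1 - b ≠ 0 := by linarith
  have : 2 * γ + b ≠ 0 := by linarith
  apply caseC γ b _ _ hγ hγ2 hb hb2 <;> field_simp

lemma choose_ab (γ q b0 : ℝ) (hγ : 0 < γ) (hq : 0 < q) (hb0 : 0 ≤ b0)
    (h1 : 3 * (1 / q) ≤ 2 * γ + b0) (h2 : 2 * (1 / q) ≤ γ + b0) (h3 : 2 * (1 / q) < γ + 1 / 2) :
    ∃ b : ℝ, 0 ≤ b ∧ b ≤ b0 ∧ b < 1 ∧ WB γ q (1 / (1 - b)) := by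
  obtain ⟨a, ha⟩ : ∃ a, a = 1 / q := ⟨_, rfl⟩
  have haq : a * q = 1 := by rw [ha]; field_simp
  rw [← ha] at h1 h2 h3
  have KA : ∀ b, 0 ≤ b → b ≤ 1 / 2 → b < γ → b ≤ b0 → 2 * a ≤ γ + b →
      ∃ b : ℝ, 0 ≤ b ∧ b ≤ b0 ∧ b < 1 ∧ WB γ q (1 / (1 - b)) := by
    intro b hb hb2 hbγ hbb hab
    refine ⟨b, hb, hbb, by linarith, WB_mono γ _ q _ hγ ?_ ?_ (WB_A γ b hγ hb hb2 hbγ)⟩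
    · rw [le_div_iff₀ (by linarith)]; linarith
    · rw [div_le_iff₀ (by linarith)]; nlinarith
  have KC : ∀ b, γ < 1 / 2 → γ < b → b < 3 / 4 - γ / 2 → b ≤ b0 → 3 * a ≤ 2 * γ + b →
      ∃ b : ℝ, 0 ≤ b ∧ b ≤ b0 ∧ b < 1 ∧ WB γ q (1 / (1 - b)) := by
    intro b hγ2 hb hb2 hbb hab
    refine ⟨b, by linarith, hbb, by linarith, WB_mono γ _ q _ hγ ?_ ?_ (WB_C γ b hγ hγ2 hb hb2)⟩
    · rw [le_div_iff₀ (by linarith)]; linarith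
    · rw [div_le_iff₀ (by linarith)]; nlinarith
  rcases lt_trichotomy γ (1 / 2) with hg | hg | hg
  · rcases lt_trichotomy b0 γ with hb | hb | hb
    · exact KA b0 hb0 (by linarith) hb le_rfl h2
    · refine ⟨γ, hγ.le, hb.ge, by linarith, WB_mono γ _ q _ hγ ?_ ?_ (caseB γ _ hγ hg ?_)⟩
      · rw [le_div_iff₀ (by linarith)]; linarith
      · rw [div_le_iff₀ (by linarith)]; nlinarith
      · have : 1 - γ ≠ 0 := by linarith
        field_simp
    · by_cases hb' : b0 < 3 / 4 - γ / 2
      · exact KC b0 hg hb hb' le_rfl h1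
      · have hb' := not_lt.1 hb'
        refine KC (max ((γ + (3 / 4 - γ / 2)) / 2) (3 * a - 2 * γ)) hg ?_ ?_ ?_ ?_
        · exact lt_max_of_lt_left (by linarith)
        · exact max_lt (by linarith) (by linarith)
        · exact max_le (by linarith) (by linarith)
        · linarith [le_max_right ((γ + (3 / 4 - γ / 2)) / 2) (3 * a - 2 * γ)]
  · by_cases hb : b0 < 1 / 2
    · exact KA b0 hb0 hb.le (by linarith) le_rfl h2
    · have hb := not_lt.1 hb
      refine KA (max (1 / 4) (2 * a - 1 / 2)) ?_ ?_ ?_ ?_ ?_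
      · exact le_max_of_le_left (by norm_num)
      · exact max_le (by linarith) (by linarith)
      · exact max_lt (by linarith) (by linarith)
      · exact max_le (by linarith) (by linarith)
      · linarith [le_max_right (1 / 4) (2 * a - 1 / 2)]
  · refine KA (min b0 (1 / 2)) ?_ (min_le_right _ _) ?_ (min_le_left _ _) ?_
    · exact le_min hb0 (by norm_num)
    · exact lt_of_le_of_lt (min_le_right _ _) hg
    · rw [← sub_le_iff_le_add']
      exact le_min (by linarith) (by linarith)

lemma hint_of_eLp (r : ℝ) (hr : 0 < r) (F : ℝ → ℂ) (h : eLpNorm F (ENNReal.ofReal r) nu ≤ 1) :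
    ∫⁻ φ, ENNReal.ofReal (‖F φ‖ ^ r) ∂nu ≤ 1 := by
  rw [eLpNorm_eq_lintegral_rpow_enorm_toReal (by simpa using hr) ENNReal.ofReal_ne_top, ENNReal.toReal_ofReal hr.le] at h
  have h2 := ENNReal.rpow_le_rpow h hr.le
  rw [← ENNReal.rpow_mul, one_div, inv_mul_cancel₀ hr.ne', ENNReal.rpow_one, ENNReal.one_rpow] at h2
  refine le_trans (le_of_eq ?_) h2
  congr 1; ext φ
  rw [← ENNReal.ofReal_rpow_of_nonneg (norm_nonneg _) hr.le, ofReal_norm]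

lemma eLp_mono (r : ℝ) (hr : 1 ≤ r) (r0 : ℝ≥0∞) (hrr : ENNReal.ofReal r ≤ r0) (F : ℝ → ℂ) (hF : Measurable F) :
    eLpNorm F (ENNReal.ofReal r) nu ≤ ENNReal.ofReal (2 * π) * eLpNorm F r0 nu := by
  refine (eLpNorm_le_eLpNorm_mul_rpow_measure_univ hrr hF.aestronglyMeasurable).trans ?_
  rw [mul_comm]
  gcongr
  have hu : nu univ = ENNReal.ofReal (2 * π) := by
    unfold nu
    rw [Measure.restrict_apply_univ, Real.volume_Ioc, sub_zero]
  rw [hu, ENNReal.toReal_ofReal (by linarith)]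
  have h1 : (1:ℝ≥0∞) ≤ ENNReal.ofReal (2 * π) := by
    rw [ENNReal.one_le_ofReal]; linarith [Real.pi_gt_three]
  calc ENNReal.ofReal (2 * π) ^ (1 / r - 1 / r0.toReal) ≤ ENNReal.ofReal (2 * π) ^ (1:ℝ) := by
        apply ENNReal.rpow_le_rpow_of_exponent_le h1
        have a1 : 1 / r ≤ 1 := by rw [div_le_one (by linarith)]; exact hr
        have a2 : 0 ≤ 1 / r0.toReal := by positivity
        linarith
    _ = _ := ENNReal.rpow_one _

lemma Rgamma_smul (γ : ℝ) (c : ℂ) (F : ℝ → ℂ) (p : ℝ × ℝ) :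
    Rgamma γ (fun φ => c * F φ) p.1 p.2 = c * Rgamma γ F p.1 p.2 := by
  unfold Rgamma
  rw [Rext_eq, Rext_eq]
  have : EF (fun φ => c * F φ) p = c * EF F p := by
    unfold EF
    rw [← integral_const_mul]
    congr 1; ext φ; ring
  rw [this]; ring

lemma final (γ q r : ℝ) (hq : 0 < q) (hr : 1 ≤ r) (r0 : ℝ≥0∞) (hr0 : r0 ≠ 0) (hrr : ENNReal.ofReal r ≤ r0) (h : WB γ q r) :
    ∃ C : ℝ, 0 < C ∧ ∀ F : ℝ → ℂ, Measurable F →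
      wplane q (fun p => Rgamma γ F p.1 p.2) ≤ ENNReal.ofReal C * circleLp r0 F := by
  obtain ⟨C, hC, H⟩ := h
  refine ⟨C ^ (1 / q) * (2 * π), by positivity, ?_⟩
  intro F hF
  change _ ≤ _ * eLpNorm F r0 nu
  unfold wplane
  refine iSup₂_le fun t ht => ?_
  by_cases h0 : eLpNorm F r0 nu = 0
  · rw [eLpNorm_eq_zero_iff hF.aestronglyMeasurable hr0] at h0
    have : {p : ℝ × ℝ | t < ‖Rgamma γ F p.1 p.2‖} = ∅ := by
      rw [eq_empty_iff_forall_notMem]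
      intro p hp
      have hE : EF F p = 0 := by
        unfold EF
        apply integral_eq_zero_of_ae
        filter_upwards [h0] with φ hφ
        rw [hφ]; simp
      have hp' : t < ‖Rgamma γ F p.1 p.2‖ := hp
      unfold Rgamma at hp'
      rw [Rext_eq, hE] at hp'
      simp at hp'
      linarith
    rw [this, measure_empty, ENNReal.zero_rpow_of_pos (by positivity), mul_zero]
    exact zero_le
  by_cases htop : eLpNorm F r0 nu = ∞
  · rw [htop, ENNReal.mul_top]
    · exact le_top
    · have : 0 < C ^ (1 / q) * (2 * π) := by positivity
      simpa using this
  obtain ⟨n, hn, hn0⟩ : ∃ n : ℝ, eLpNorm F r0 nu = ENNReal.ofReal n ∧ 0 < n :=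
    ⟨_, (ENNReal.ofReal_toReal htop).symm, ENNReal.toReal_pos h0 htop⟩
  obtain ⟨N, hN⟩ : ∃ N, N = 2 * π * n := ⟨_, rfl⟩
  have hN0 : 0 < N := by rw [hN]; positivity
  have hle : eLpNorm F (ENNReal.ofReal r) nu ≤ ENNReal.ofReal N := by
    refine (eLp_mono r hr r0 hrr F hF).trans ?_
    rw [hn, ← ENNReal.ofReal_mul (by positivity), hN]
  have hG : eLpNorm (fun φ => ((N⁻¹ : ℝ) : ℂ) * F φ) (ENNReal.ofReal r) nu ≤ 1 := by
    have := eLpNorm_const_smul ((N⁻¹ : ℝ) : ℂ) F (ENNReal.ofReal r) nu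
    change eLpNorm (((N⁻¹ : ℝ) : ℂ) • F) (ENNReal.ofReal r) nu ≤ 1
    rw [this, ← ofReal_norm, Complex.norm_real, Real.norm_of_nonneg (by positivity)]
    refine (mul_le_mul_right hle _).trans (le_of_eq ?_)
    rw [← ENNReal.ofReal_mul (by positivity), inv_mul_cancel₀ hN0.ne', ENNReal.ofReal_one]
  have key := H _ (hF.const_mul _) (hint_of_eLp r (by linarith) _ hG) (t / N) (by positivity)
  have hset : {p : ℝ × ℝ | t / N < ‖Rgamma γ (fun φ => ((N⁻¹ : ℝ) : ℂ) * F φ) p.1 p.2‖} =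
      {p : ℝ × ℝ | t < ‖Rgamma γ F p.1 p.2‖} := by
    ext p
    rw [mem_ofPred_eq, mem_ofPred_eq, Rgamma_smul, norm_mul, Complex.norm_real, Real.norm_of_nonneg (by positivity),
      inv_mul_eq_div, div_lt_div_iff_of_pos_right hN0]
  rw [hset] at key
  refine (mul_le_mul_right (ENNReal.rpow_le_rpow key (by positivity : 0 ≤ 1 / q)) _).trans (le_of_eq ?_)
  have htN : 0 < t / N := by positivity
  rw [hn, ENNReal.ofReal_rpow_of_nonneg (by positivity) (by positivity), ← ENNReal.ofReal_mul ht.le,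
    ← ENNReal.ofReal_mul (by positivity), Real.mul_rpow hC.le (by positivity), ← Real.rpow_mul htN.le]
  congr 1
  rw [show -q * (1 / q) = -1 by field_simp, Real.rpow_neg_one, inv_div, hN]
  field_simp

/-- Lemma 17: weak-type bound `R*_γ : L^r(S¹) → L^{q,∞}(ℝ²)`. -/
theorem statement14 (γ q : ℝ) (hγ : 0 < γ)
    (r : ℝ≥0∞) (hr : 1 ≤ r) (hq : 0 < q)
    (h1 : γ ≥ max (3 / (2 * q) - (1 - r⁻¹.toReal) / 2) (2 / q - (1 - r⁻¹.toReal)))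
    (h2 : γ > 2 / q - 1 / 2) :
    ∃ C : ℝ, 0 < C ∧ ∀ F : ℝ → ℂ, Measurable F →
      wplane q (fun p => Rgamma γ F p.1 p.2) ≤ ENNReal.ofReal C * circleLp r F := by

  have hr0 : r ≠ 0 := (lt_of_lt_of_le one_pos hr).ne'
  have hinv : r⁻¹ ≤ 1 := ENNReal.inv_le_one.2 hr
  have hinv' : r⁻¹.toReal ≤ 1 := by
    simpa using ENNReal.toReal_mono ENNReal.one_ne_top hinv
  have ha : 3 / (2 * q) = 3 / 2 * (1 / q) := by field_simp
  have hb : 2 / q = 2 * (1 / q) := by field_simp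
  have e1 := (le_max_left _ _).trans h1
  have e2 := (le_max_right _ _).trans h1
  rw [ha] at e1
  rw [hb] at e2 h2
  obtain ⟨b, hb0, hbb, hb1, hW⟩ := choose_ab γ q (1 - r⁻¹.toReal) hγ hq (by linarith) (by linarith) (by linarith) (by linarith)
  refine final γ q (1 / (1 - b)) hq ?_ r hr0 ?_ hW
  · rw [le_div_iff₀ (by linarith)]; linarith
  · by_cases hrt : r = ∞
    · rw [hrt]; exact le_top
    · rw [ENNReal.ofReal_le_iff_le_toReal hrt]
      rw [ENNReal.toReal_inv] at hbb
      have hrp : 0 < r.toReal := ENNReal.toReal_pos hr0 hrt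
      rw [div_le_iff₀ (by linarith)]
      have : r.toReal * (r.toReal)⁻¹ = 1 := mul_inv_cancel₀ hrp.ne'
      nlinarith
end
end

section
/- Let 0 ≤ γ < ∞, 1 ≤ r ≤ ∞ and 0 < q < ∞. If there exists C > 0 such that ‖R*_γF‖_{L^q(ℝ²)} ≤ C · ‖F‖_{L^r(S¹)} for all measurable F : ℝ → ℂ, then γ > 2/q − 1/2. -/
open MeasureTheory Real Set Filter
open scoped ENNReal

noncomputable section

lemma hasDerivAt_param (f f' : ℝ → ℝ → ℝ) (hf : Continuous (Function.uncurry f))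
    (hf' : Continuous (Function.uncurry f'))
    (hd : ∀ ρ φ, HasDerivAt (fun s => f s φ) (f' ρ φ) ρ)
    (hb : ∀ ρ φ, |f' ρ φ| ≤ 1) (ρ : ℝ) :
    HasDerivAt (fun s => ∫ φ in (0:ℝ)..(2 * π), f s φ) (∫ φ in (0:ℝ)..(2 * π), f' ρ φ) ρ := by
  refine (intervalIntegral.hasDerivAt_integral_of_dominated_loc_of_deriv_le
    (bound := fun _ => 1) (s := univ) univ_mem ?_ ?_ ?_ ?_ ?_ ?_).2
  · refine Eventually.of_forall fun s => ?_
    exact (hf.comp (by fun_prop : Continuous fun φ => (s, φ))).aestronglyMeasurable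
  · exact (hf.comp (by fun_prop : Continuous fun φ => (ρ, φ))).intervalIntegrable _ _
  · exact (hf'.comp (by fun_prop : Continuous fun φ => (ρ, φ))).aestronglyMeasurable
  · exact Eventually.of_forall fun φ _ s _ => hb s φ
  · exact intervalIntegrable_const
  · exact Eventually.of_forall fun φ _ s _ => hd s φ

def J0 (ρ : ℝ) : ℝ := ∫ φ in (0:ℝ)..(2 * π), Real.cos (ρ * Real.cos φ)
def J1 (ρ : ℝ) : ℝ := ∫ φ in (0:ℝ)..(2 * π), -(Real.cos φ * Real.sin (ρ * Real.cos φ))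
def J2 (ρ : ℝ) : ℝ := ∫ φ in (0:ℝ)..(2 * π), -(Real.cos φ ^ 2 * Real.cos (ρ * Real.cos φ))

lemma hJ0 (ρ : ℝ) : HasDerivAt J0 (J1 ρ) ρ := by
  refine hasDerivAt_param (fun ρ φ => Real.cos (ρ * Real.cos φ))
    (fun ρ φ => -(Real.cos φ * Real.sin (ρ * Real.cos φ))) ?_ ?_ ?_ ?_ ρ
  · unfold Function.uncurry; fun_prop
  · unfold Function.uncurry; fun_prop
  · intro ρ φ
    exact ((hasDerivAt_id ρ).mul_const (Real.cos φ)).cos.congr_deriv (by simp only [id]; ring)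
  · intro ρ φ
    rw [abs_neg, abs_mul]
    exact mul_le_one₀ (Real.abs_cos_le_one _) (abs_nonneg _) (Real.abs_sin_le_one _)

lemma hJ1 (ρ : ℝ) : HasDerivAt J1 (J2 ρ) ρ := by
  refine hasDerivAt_param (fun ρ φ => -(Real.cos φ * Real.sin (ρ * Real.cos φ)))
    (fun ρ φ => -(Real.cos φ ^ 2 * Real.cos (ρ * Real.cos φ))) ?_ ?_ ?_ ?_ ρ
  · unfold Function.uncurry; fun_prop
  · unfold Function.uncurry; fun_prop
  · intro ρ φ
    exact (((hasDerivAt_id ρ).mul_const (Real.cos φ)).sin.const_mul (Real.cos φ)).neg.congr_deriv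
      (by simp only [id]; ring)
  · intro ρ φ
    rw [abs_neg, abs_mul, abs_pow]
    exact mul_le_one₀ (pow_le_one₀ (abs_nonneg _) (Real.abs_cos_le_one _)) (abs_nonneg _)
      (Real.abs_cos_le_one _)

lemma bessel_ode (ρ : ℝ) : ρ * J2 ρ = - J1 ρ - ρ * J0 ρ := by
  have h : ∫ φ in (0:ℝ)..(2 * π), (Real.cos φ * Real.sin (ρ * Real.cos φ) +
      Real.sin φ * (Real.cos (ρ * Real.cos φ) * (ρ * (-Real.sin φ)))) = 0 := by
    rw [intervalIntegral.integral_eq_sub_of_hasDerivAt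
      (f := fun φ => Real.sin φ * Real.sin (ρ * Real.cos φ))]
    · simp
    · intro φ _
      exact (Real.hasDerivAt_sin φ).mul (((Real.hasDerivAt_cos φ).const_mul ρ).sin)
    · exact Continuous.intervalIntegrable (by fun_prop) _ _
  have h2 : ρ * J2 ρ + J1 ρ + ρ * J0 ρ = -∫ φ in (0:ℝ)..(2 * π),
      (Real.cos φ * Real.sin (ρ * Real.cos φ) +
      Real.sin φ * (Real.cos (ρ * Real.cos φ) * (ρ * (-Real.sin φ)))) := by
    unfold J0 J1 J2
    rw [← intervalIntegral.integral_const_mul, ← intervalIntegral.integral_const_mul,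
      ← intervalIntegral.integral_add, ← intervalIntegral.integral_add,
      ← intervalIntegral.integral_neg]
    · congr 1
      ext φ
      have := Real.sin_sq_add_cos_sq φ
      linear_combination (-ρ * Real.cos (ρ * Real.cos φ)) * this
    all_goals exact Continuous.intervalIntegrable (by fun_prop) _ _
  rw [h] at h2
  linarith

lemma J0_cont : Continuous J0 := continuous_iff_continuousAt.2 fun x => (hJ0 x).continuousAt
lemma J1_cont : Continuous J1 := continuous_iff_continuousAt.2 fun x => (hJ1 x).continuousAt

lemma J0_one_pos : 0 < J0 1 := by
  refine intervalIntegral.intervalIntegral_pos_of_pos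
    (Continuous.intervalIntegrable (by fun_prop) _ _) (fun φ => ?_) (by positivity)
  refine Real.cos_pos_of_mem_Ioo ⟨?_, ?_⟩ <;>
    nlinarith [Real.neg_one_le_cos φ, Real.cos_le_one φ, Real.pi_gt_three]

def BB (ρ : ℝ) : ℝ := ρ * (J0 ρ ^ 2 + J1 ρ ^ 2) + J0 ρ * J1 ρ

lemma hBB (ρ : ℝ) (h : 0 < ρ) : HasDerivAt BB (-(J0 ρ * J1 ρ) / ρ) ρ := by
  have h0 := hJ0 ρ
  have h1 := hJ1 ρ
  refine (((hasDerivAt_id ρ).mul ((h0.pow 2).add (h1.pow 2))).add (h0.mul h1)).congr_deriv ?_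
  have := bessel_ode ρ
  have e : J2 ρ = (- J1 ρ - ρ * J0 ρ) / ρ := by field_simp; linarith
  rw [e]
  simp
  field_simp
  ring

lemma BB_ge (ρ : ℝ) (h : 1 ≤ ρ) : ρ / 2 * (J0 ρ ^ 2 + J1 ρ ^ 2) ≤ BB ρ := by
  unfold BB
  nlinarith [sq_nonneg (J0 ρ + J1 ρ), mul_nonneg (sub_nonneg.2 h)
    (add_nonneg (sq_nonneg (J0 ρ)) (sq_nonneg (J1 ρ)))]

lemma BB_le (ρ : ℝ) (h : 1 ≤ ρ) : BB ρ ≤ 2 * (ρ * (J0 ρ ^ 2 + J1 ρ ^ 2)) := by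
  unfold BB
  nlinarith [sq_nonneg (J0 ρ - J1 ρ), mul_nonneg (sub_nonneg.2 h)
    (add_nonneg (sq_nonneg (J0 ρ)) (sq_nonneg (J1 ρ)))]

lemma BB_deriv_bound (ρ : ℝ) (h : 1 ≤ ρ) :
    |-(J0 ρ * J1 ρ) / ρ| ≤ BB ρ / ρ ^ 2 := by
  have hp : 0 < ρ := by linarith
  rw [abs_div, abs_of_pos hp, div_le_div_iff₀ hp (by positivity), abs_neg]
  have h1 := BB_ge ρ h
  have h2 : |J0 ρ * J1 ρ| ≤ (J0 ρ ^ 2 + J1 ρ ^ 2) / 2 :=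
    abs_le.2 ⟨by nlinarith [sq_nonneg (J0 ρ + J1 ρ)], by nlinarith [sq_nonneg (J0 ρ - J1 ρ)]⟩
  have h3 : |J0 ρ * J1 ρ| * ρ ≤ BB ρ := by nlinarith
  nlinarith

lemma BB_lower (ρ : ℝ) (h : 1 ≤ ρ) : BB 1 * Real.exp (-1) ≤ BB ρ := by
  have hd : ∀ x, 1 ≤ x → HasDerivAt (fun x => BB x * Real.exp (-x⁻¹))
      (-(J0 x * J1 x) / x * Real.exp (-x⁻¹) +
        BB x * (Real.exp (-x⁻¹) * (-(-(x ^ 2)⁻¹)))) x := fun x hx =>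
    (hBB x (by linarith)).mul ((hasDerivAt_inv (by linarith)).neg.exp)
  have hm : MonotoneOn (fun x => BB x * Real.exp (-x⁻¹)) (Ici 1) := by
    refine monotoneOn_of_deriv_nonneg (convex_Ici 1)
      (fun x hx => (hd x hx).continuousAt.continuousWithinAt)
      (fun x hx => (hd x (interior_subset hx)).differentiableAt.differentiableWithinAt)
      (fun x hx => ?_)
    have hx : 1 ≤ x := interior_subset hx
    rw [(hd x hx).deriv]
    have := (abs_le.1 (BB_deriv_bound x hx)).1
    rw [div_eq_mul_inv (BB x)] at this
    nlinarith [Real.exp_pos (-x⁻¹)]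
  have := hm (mem_Ici.2 le_rfl) (mem_Ici.2 h) h
  simp only [inv_one] at this
  refine this.trans ?_
  have hB : 0 ≤ BB ρ := le_trans (by positivity) (BB_ge ρ h)
  exact mul_le_of_le_one_right hB (Real.exp_le_one_iff.2 (by simp; linarith))

lemma BB_upper (ρ : ℝ) (h : 1 ≤ ρ) : BB ρ ≤ BB 1 * Real.exp 1 := by
  have hd : ∀ x, 1 ≤ x → HasDerivAt (fun x => BB x * Real.exp (x⁻¹))
      (-(J0 x * J1 x) / x * Real.exp (x⁻¹) +
        BB x * (Real.exp (x⁻¹) * (-(x ^ 2)⁻¹))) x := fun x hx =>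
    (hBB x (by linarith)).mul ((hasDerivAt_inv (by linarith)).exp)
  have hm : AntitoneOn (fun x => BB x * Real.exp (x⁻¹)) (Ici 1) := by
    refine antitoneOn_of_deriv_nonpos (convex_Ici 1)
      (fun x hx => (hd x hx).continuousAt.continuousWithinAt)
      (fun x hx => (hd x (interior_subset hx)).differentiableAt.differentiableWithinAt)
      (fun x hx => ?_)
    have hx : 1 ≤ x := interior_subset hx
    rw [(hd x hx).deriv]
    have := (abs_le.1 (BB_deriv_bound x hx)).2
    rw [div_eq_mul_inv (BB x)] at this
    nlinarith [Real.exp_pos (x⁻¹)]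
  have := hm (mem_Ici.2 le_rfl) (mem_Ici.2 h) h
  simp only [inv_one] at this
  refine le_trans ?_ this
  have hB : 0 ≤ BB ρ := le_trans (by positivity) (BB_ge ρ h)
  exact le_mul_of_one_le_right hB (Real.one_le_exp_iff.2 (by positivity))

/-- energy bounds -/
lemma energy : ∃ c M : ℝ, 0 < c ∧ 0 < M ∧ ∀ ρ, 1 ≤ ρ →
    c / ρ ≤ J0 ρ ^ 2 + J1 ρ ^ 2 ∧ ρ * (J0 ρ ^ 2 + J1 ρ ^ 2) ≤ M := by
  have hB : 0 < BB 1 := by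
    have := BB_ge 1 le_rfl
    have := J0_one_pos
    nlinarith [sq_nonneg (J1 1), pow_pos this 2]
  refine ⟨BB 1 * Real.exp (-1) / 2, BB 1 * Real.exp 1 * 2, by positivity, by positivity,
    fun ρ h => ⟨?_, ?_⟩⟩
  · rw [div_le_iff₀ (by linarith)]
    have := BB_lower ρ h
    have := BB_le ρ h
    linarith
  · have := BB_upper ρ h
    have := BB_ge ρ h
    linarith

lemma log_lower : ∃ c M K : ℝ, 0 < c ∧ 0 < M ∧ (∀ ρ, 1 ≤ ρ → ρ * J0 ρ ^ 2 ≤ M) ∧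
    ∀ T, 1 ≤ T → c * Real.log T - K ≤ ∫ ρ in (1:ℝ)..T, J0 ρ ^ 2 := by
  obtain ⟨c, M, hc, hM, h⟩ := energy
  refine ⟨c / 2, M, M / 2, by positivity, hM, fun ρ hρ => ?_, fun T hT => ?_⟩
  · nlinarith [(h ρ hρ).2, sq_nonneg (J1 ρ)]
  have c0 := J0_cont
  have c1 := J1_cont
  have i0 : IntervalIntegrable (fun ρ => J0 ρ ^ 2) volume 1 T :=
    Continuous.intervalIntegrable (by fun_prop) _ _
  have i1 : IntervalIntegrable (fun ρ => J1 ρ ^ 2) volume 1 T :=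
    Continuous.intervalIntegrable (by fun_prop) _ _
  have e1 : ∫ ρ in (1:ℝ)..T, (J0 ρ ^ 2 - J1 ρ ^ 2) =
      T * (J0 T ^ 2 + J1 T ^ 2) - 1 * (J0 1 ^ 2 + J1 1 ^ 2) := by
    refine intervalIntegral.integral_eq_sub_of_hasDerivAt
      (f := fun ρ => ρ * (J0 ρ ^ 2 + J1 ρ ^ 2)) (fun ρ _ => ?_) (i0.sub i1)
    refine ((hasDerivAt_id ρ).mul (((hJ0 ρ).pow 2).add ((hJ1 ρ).pow 2))).congr_deriv ?_
    simp
    linear_combination (2 * J1 ρ) * bessel_ode ρ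
  have e2 : c * Real.log T ≤ ∫ ρ in (1:ℝ)..T, (J0 ρ ^ 2 + J1 ρ ^ 2) := by
    have : ∫ ρ in (1:ℝ)..T, c * ρ⁻¹ = c * Real.log T := by
      rw [intervalIntegral.integral_const_mul, integral_inv_of_pos one_pos (by linarith)]
      simp
    rw [← this]
    refine intervalIntegral.integral_mono_on hT ?_ (i0.add i1) ?_
    · refine ContinuousOn.intervalIntegrable ?_
      rw [uIcc_of_le hT]
      refine continuousOn_const.mul (continuousOn_id.inv₀ fun x hx => ?_)
      have := hx.1
      simp; linarith
    · intro ρ hρ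
      have := (h ρ hρ.1).1
      rwa [div_eq_mul_inv] at this
  rw [intervalIntegral.integral_add i0 i1] at e2
  rw [intervalIntegral.integral_sub i0 i1] at e1
  have := (h 1 le_rfl).2
  have : 0 ≤ T * (J0 T ^ 2 + J1 T ^ 2) := by positivity
  linarith

lemma main_lower (q : ℝ) (hq : 0 < q) : ∃ a K : ℝ, 0 < a ∧ ∀ T, 1 ≤ T →
    a * Real.log T - K ≤ ∫ ρ in (1:ℝ)..T, |J0 ρ| ^ q * ρ ^ (q / 2 - 1) := by
  obtain ⟨c, M, K, hc, hM, hv, h⟩ := log_lower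
  set δ := c / 2 with hδ
  have hδ0 : 0 < δ := by positivity
  set D := δ ^ (q / 2) / M with hD
  have hD0 : 0 < D := by positivity
  refine ⟨D * (c / 2), D * K, by positivity, fun T hT => ?_⟩
  have c0 := J0_cont
  have i0 : IntervalIntegrable (fun ρ => J0 ρ ^ 2) volume 1 T :=
    Continuous.intervalIntegrable (by fun_prop) _ _
  have i1 : IntervalIntegrable (fun ρ : ℝ => δ * ρ⁻¹) volume 1 T := by
    refine ContinuousOn.intervalIntegrable ?_
    rw [uIcc_of_le hT]
    refine continuousOn_const.mul (continuousOn_id.inv₀ fun x hx => ?_)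
    have := hx.1
    simp; linarith
  have e : ∫ ρ in (1:ℝ)..T, D * (J0 ρ ^ 2 - δ * ρ⁻¹) =
      D * ((∫ ρ in (1:ℝ)..T, J0 ρ ^ 2) - δ * Real.log T) := by
    rw [intervalIntegral.integral_const_mul, intervalIntegral.integral_sub i0 i1,
      intervalIntegral.integral_const_mul, integral_inv_of_pos one_pos (by linarith)]
    simp
  have e2 : D * (c / 2) * Real.log T - D * K ≤
      ∫ ρ in (1:ℝ)..T, D * (J0 ρ ^ 2 - δ * ρ⁻¹) := by
    rw [e]
    have := mul_le_mul_of_nonneg_left (h T hT) hD0.le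
    rw [hδ]
    linarith
  refine e2.trans (intervalIntegral.integral_mono_on hT ((i0.sub i1).const_mul D) ?_ ?_)
  · refine ContinuousOn.intervalIntegrable ?_
    rw [uIcc_of_le hT]
    refine ContinuousOn.mul (c0.abs.rpow_const fun x => Or.inr hq.le).continuousOn ?_
    exact continuousOn_id.rpow_const fun x hx => Or.inl (by have := hx.1; simp; linarith)
  · intro ρ hρ
    have hρ1 := hρ.1
    have hp : 0 < ρ := by linarith
    by_cases hc : J0 ρ ^ 2 ≤ δ * ρ⁻¹
    · have : 0 ≤ |J0 ρ| ^ q * ρ ^ (q / 2 - 1) := by positivity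
      nlinarith
    · push Not at hc
      have h1 : |J0 ρ| ^ q = (J0 ρ ^ 2) ^ (q / 2) := by
        rw [← sq_abs, ← Real.rpow_natCast, ← Real.rpow_mul (abs_nonneg _)]
        congr 1; push_cast; ring
      have h2 : (δ * ρ⁻¹) ^ (q / 2) ≤ (J0 ρ ^ 2) ^ (q / 2) :=
        Real.rpow_le_rpow (by positivity) hc.le (by positivity)
      rw [h1]
      have h3 : δ ^ (q / 2) * ρ⁻¹ = (δ * ρ⁻¹) ^ (q / 2) * ρ ^ (q / 2 - 1) := by
        rw [Real.mul_rpow hδ0.le (by positivity), Real.inv_rpow hp.le, Real.rpow_sub_one hp.ne']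
        field_simp
      have h4 : D * (J0 ρ ^ 2 - δ * ρ⁻¹) ≤ δ ^ (q / 2) * ρ⁻¹ := by
        have : J0 ρ ^ 2 ≤ M * ρ⁻¹ := by
          rw [← div_eq_mul_inv, le_div_iff₀ hp]
          linarith [hv ρ hρ1]
        calc D * (J0 ρ ^ 2 - δ * ρ⁻¹) ≤ D * (M * ρ⁻¹) := by
              apply mul_le_mul_of_nonneg_left _ hD0.le
              have : 0 < δ * ρ⁻¹ := by positivity
              linarith
          _ = δ ^ (q / 2) * ρ⁻¹ := by rw [hD]; field_simp
      rw [h3] at h4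
      exact h4.trans (mul_le_mul_of_nonneg_right h2 (by positivity))

lemma Rext_lower (ρ θ : ℝ) :
    1 / (2 * π) * |J0 ρ| ≤ ‖Rext (fun _ => 1) (ρ * Real.cos θ) (ρ * Real.sin θ)‖ := by
  unfold Rext
  rw [norm_mul, Complex.norm_real, Real.norm_of_nonneg (by positivity)]
  refine mul_le_mul_of_nonneg_left ?_ (by positivity)
  refine le_trans (le_of_eq ?_) (Complex.abs_re_le_norm _)
  congr 1
  have hi : IntervalIntegrable (fun φ : ℝ => (1:ℂ) * Complex.exp (Complex.I *
      Complex.ofReal (ρ * Real.cos θ * Real.cos φ + ρ * Real.sin θ * Real.sin φ)))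
      volume 0 (2 * π) := Continuous.intervalIntegrable (by fun_prop) _ _
  have := Complex.reCLM.intervalIntegral_comp_comm hi
  simp only [Complex.reCLM_apply] at this
  rw [← this]
  have e : ∀ φ : ℝ, ((1:ℂ) * Complex.exp (Complex.I *
      Complex.ofReal (ρ * Real.cos θ * Real.cos φ + ρ * Real.sin θ * Real.sin φ))).re =
      Real.cos (ρ * Real.cos (φ - θ)) := by
    intro φ
    rw [one_mul, mul_comm Complex.I, Complex.exp_ofReal_mul_I_re, Real.cos_sub]
    congr 1; ring
  simp only [e]
  rw [intervalIntegral.integral_comp_sub_right (fun φ => Real.cos (ρ * Real.cos φ)) θ]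
  have hp : Function.Periodic (fun φ => Real.cos (ρ * Real.cos φ)) (2 * π) := by
    intro x; simp
  have := hp.intervalIntegral_add_eq 0 (0 - θ)
  rw [zero_add, show 0 - θ + 2 * π = 2 * π - θ by ring] at this
  exact this

lemma pt_lower (γ : ℝ) (hγ : 0 ≤ γ) (q : ℝ) (hq : 0 < q) (h : γ ≤ 2 / q - 1 / 2)
    (ρ θ : ℝ) (hρ : 1 ≤ ρ) :
    (1 / (2 * π) * 3 ^ (-γ)) ^ q * (|J0 ρ| ^ q * ρ ^ (q / 2 - 1)) ≤
      ρ * ‖Rgamma γ (fun _ => 1) (ρ * Real.cos θ) (ρ * Real.sin θ)‖ ^ q := by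
  have hp : 0 < ρ := by linarith
  have hw : (3 * ρ) ^ (-γ) ≤ (1 + |ρ * Real.cos θ| + |ρ * Real.sin θ|) ^ (-γ) := by
    refine Real.rpow_le_rpow_of_nonpos (by positivity) ?_ (by linarith)
    rw [abs_mul, abs_mul, abs_of_pos hp]
    nlinarith [Real.abs_cos_le_one θ, Real.abs_sin_le_one θ]
  have hn : 1 / (2 * π) * |J0 ρ| * (3 * ρ) ^ (-γ) ≤
      ‖Rgamma γ (fun _ => 1) (ρ * Real.cos θ) (ρ * Real.sin θ)‖ := by
    unfold Rgamma
    rw [norm_mul, Complex.norm_real, Real.norm_of_nonneg (by positivity)]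
    exact mul_le_mul (Rext_lower ρ θ) hw (by positivity) (norm_nonneg _)
  have hn2 := Real.rpow_le_rpow (by positivity) hn hq.le
  refine le_trans ?_ (mul_le_mul_of_nonneg_left hn2 hp.le)
  have e : ρ * (1 / (2 * π) * |J0 ρ| * (3 * ρ) ^ (-γ)) ^ q =
      (1 / (2 * π) * 3 ^ (-γ)) ^ q * (|J0 ρ| ^ q * ρ ^ (1 - γ * q)) := by
    rw [Real.mul_rpow (by norm_num : (0:ℝ) ≤ 3) hp.le,
      show 1 / (2 * π) * |J0 ρ| * (3 ^ (-γ) * ρ ^ (-γ)) =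
        (1 / (2 * π) * 3 ^ (-γ)) * (|J0 ρ| * ρ ^ (-γ)) by ring,
      Real.mul_rpow (by positivity) (by positivity),
      Real.mul_rpow (abs_nonneg _) (by positivity), ← Real.rpow_mul hp.le,
      show 1 - γ * q = 1 + -γ * q by ring, Real.rpow_add hp, Real.rpow_one]
    ring
  rw [e]
  refine mul_le_mul_of_nonneg_left (mul_le_mul_of_nonneg_left
    (Real.rpow_le_rpow_of_exponent_le hρ ?_) (by positivity)) (by positivity)
  · have := mul_le_mul_of_nonneg_right h hq.le
    have e : (2 / q - 1 / 2) * q = 2 - q / 2 := by field_simp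
    linarith

/-- Lemma 19 (necessity): boundedness of `R*_γ : L^r(S¹) → L^q(ℝ²)` forces
`γ > 2/q - 1/2`. -/
theorem statement15 (γ : ℝ) (hγ : 0 ≤ γ)
    (r : ℝ≥0∞) (hr : 1 ≤ r) (q : ℝ) (hq : 0 < q)
    (hbdd : ∃ C : ℝ, 0 < C ∧ ∀ F : ℝ → ℂ, Measurable F →
      planeLp (ENNReal.ofReal q) (fun p => Rgamma γ F p.1 p.2) ≤
        ENNReal.ofReal C * circleLp r F) :
    γ > 2 / q - 1 / 2 := by
  by_contra hcon
  have hle : γ ≤ 2 / q - 1 / 2 := not_lt.1 hcon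
  obtain ⟨C, hC, hb⟩ := hbdd
  have hb := hb (fun _ => 1) measurable_const
  have hfin : circleLp r (fun _ => 1) < ∞ := by
    unfold circleLp
    exact (memLp_const (1:ℂ)).2
  have hlt : planeLp (ENNReal.ofReal q) (fun p => Rgamma γ (fun _ => 1) p.1 p.2) < ∞ :=
    hb.trans_lt (ENNReal.mul_lt_top ENNReal.ofReal_lt_top hfin)
  unfold planeLp at hlt
  have hlt2 := lintegral_rpow_enorm_lt_top_of_eLpNorm_lt_top
    (by simpa using hq) ENNReal.ofReal_ne_top hlt
  rw [ENNReal.toReal_ofReal hq.le] at hlt2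
  rw [← lintegral_comp_polarCoord_symm] at hlt2
  obtain ⟨a, K, ha, hm⟩ := main_lower q hq
  set κ : ℝ := (1 / (2 * π) * 3 ^ (-γ)) ^ q with hκ
  have hκ0 : 0 < κ := by positivity
  set h : ℝ → ℝ := fun ρ => |J0 ρ| ^ q * ρ ^ (q / 2 - 1) with hh
  set I := ∫⁻ p in polarCoord.target, ENNReal.ofReal p.1 •
    ‖Rgamma γ (fun _ => 1) (polarCoord.symm p).1 (polarCoord.symm p).2‖ₑ ^ q with hI
  have key : ∀ T : ℝ, 1 ≤ T → κ * (a * Real.log T - K) ≤ I.toReal := by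
    intro T hT
    have hmT := hm T hT
    have c0 := J0_cont
    have hcont : ContinuousOn h (Icc 1 T) := by
      refine ContinuousOn.mul (c0.abs.rpow_const fun x => Or.inr hq.le).continuousOn ?_
      exact continuousOn_id.rpow_const fun x hx => Or.inl (by have := hx.1; simp; linarith)
    have hint : IntegrableOn (fun ρ => κ * h ρ) (Ioc 1 T) :=
      ((hcont.integrableOn_Icc).mono_set Ioc_subset_Icc_self).const_mul κ
    have hnn : ∀ ρ, ρ ∈ Ioc 1 T → 0 ≤ κ * h ρ := fun ρ hρ => by
      have : 0 < ρ := by linarith [hρ.1]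
      simp only [hh]; positivity
    have e1 : ENNReal.ofReal (∫ ρ in Ioc 1 T, κ * h ρ) =
        ∫⁻ ρ in Ioc 1 T, ENNReal.ofReal (κ * h ρ) :=
      ofReal_integral_eq_lintegral_ofReal hint
        ((ae_restrict_iff' measurableSet_Ioc).2 (Eventually.of_forall hnn))
    have e2 : ∫⁻ ρ in Ioc 1 T, ENNReal.ofReal (κ * h ρ) ≤ I := by
      have hmeas : Measurable fun ρ => ENNReal.ofReal (κ * h ρ) := by
        have := c0.measurable
        simp only [hh]
        fun_prop
      calc ∫⁻ ρ in Ioc 1 T, ENNReal.ofReal (κ * h ρ)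
          ≤ (∫⁻ ρ in Ioc 1 T, ENNReal.ofReal (κ * h ρ)) * volume (Ioc (0:ℝ) 1) := by simp
        _ = ∫⁻ p in (Ioc 1 T) ×ˢ (Ioc (0:ℝ) 1), ENNReal.ofReal (κ * h p.1) := by
            rw [Measure.volume_eq_prod, ← Measure.prod_restrict,
              lintegral_prod (fun p : ℝ × ℝ => ENNReal.ofReal (κ * h p.1))
                (hmeas.comp measurable_fst).aemeasurable]
            simp
        _ ≤ ∫⁻ p in (Ioc 1 T) ×ˢ (Ioc (0:ℝ) 1), ENNReal.ofReal p.1 •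
              ‖Rgamma γ (fun _ => 1) (polarCoord.symm p).1 (polarCoord.symm p).2‖ₑ ^ q := by
            refine setLIntegral_mono' (measurableSet_Ioc.prod measurableSet_Ioc) fun p hp => ?_
            have h1 := pt_lower γ hγ q hq hle p.1 p.2 hp.1.1.le
            have hp0 : 0 ≤ p.1 := by linarith [hp.1.1]
            rw [polarCoord_symm_apply, ← ofReal_norm, ENNReal.ofReal_rpow_of_nonneg
              (norm_nonneg _) hq.le, smul_eq_mul, ← ENNReal.ofReal_mul hp0]
            exact ENNReal.ofReal_le_ofReal h1
        _ ≤ I := by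
            refine lintegral_mono_set ?_
            rintro ⟨x, y⟩ ⟨hx, hy⟩
            simp only [polarCoord_target]
            exact ⟨lt_trans one_pos hx.1, by linarith [hy.1, Real.pi_pos],
              lt_of_le_of_lt hy.2 (by linarith [Real.pi_gt_three])⟩
    rw [← e1] at e2
    have e3 := (ENNReal.ofReal_le_iff_le_toReal hlt2.ne).1 e2
    refine le_trans ?_ e3
    rw [integral_const_mul, ← intervalIntegral.integral_of_le hT]
    exact mul_le_mul_of_nonneg_left hmT hκ0.le
  have k2 := key (Real.exp ((I.toReal / κ + |K| + 1) / a))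
    (Real.one_le_exp (by have := ENNReal.toReal_nonneg (a := I); positivity))
  rw [Real.log_exp, mul_div_cancel₀ _ ha.ne'] at k2
  have : κ * (I.toReal / κ) = I.toReal := by field_simp
  nlinarith [le_abs_self K, mul_le_mul_of_nonneg_left (le_abs_self K) hκ0.le]
end
end

section
/- Let 0 ≤ γ < ∞, 1 ≤ r ≤ ∞ and 0 < q < ∞, and suppose there exists C > 0 with ‖R*_γF‖_{L^q(ℝ²)} ≤ C · ‖F‖_{L^r(S¹)} for all measurable F : ℝ → ℂ. Then: (i) if γ = 2/q, then r > 1; (ii) if 1/q < γ < 2/q, then γ ≥ 2/q − 1/r′; (iii) if γ = 1/q, then 1/q < 1/r′; (iv) if γ < 1/q, then γ ≥ 3/(2q) − 1/(2r′). -/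
open MeasureTheory Real Set Filter
open scoped ENNReal

noncomputable section

lemma knapp_lower (δ : ℝ) (h0 : 0 < δ) (h1 : δ ≤ 1) (x y : ℝ) (hx : |x| * δ ^ 2 ≤ 1)
    (hy : |y| * δ ≤ 1 / 2) :
    δ / (4 * π) ≤ ‖Rext ((Ioc (0:ℝ) δ).indicator (fun _ => (1:ℂ))) x y‖ := by
  have hpi := Real.pi_gt_three
  have key : (∫ φ in (0:ℝ)..(2 * π), (Ioc (0:ℝ) δ).indicator (fun _ => (1:ℂ)) φ *
      Complex.exp (Complex.I * Complex.ofReal (x * Real.cos φ + y * Real.sin φ)))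
      = Complex.exp (Complex.I * Complex.ofReal x) * ∫ φ in (0:ℝ)..δ,
        Complex.exp (Complex.I * Complex.ofReal (x * (Real.cos φ - 1) + y * Real.sin φ)) := by
    rw [intervalIntegral.integral_of_le (by positivity), intervalIntegral.integral_of_le h0.le,
      ← integral_const_mul]
    have : ∀ φ : ℝ, (Ioc (0:ℝ) δ).indicator (fun _ => (1:ℂ)) φ *
      Complex.exp (Complex.I * Complex.ofReal (x * Real.cos φ + y * Real.sin φ)) =
      (Ioc (0:ℝ) δ).indicator (fun φ : ℝ => Complex.exp (Complex.I * Complex.ofReal x) *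
        Complex.exp (Complex.I * Complex.ofReal (x * (Real.cos φ - 1) + y * Real.sin φ))) φ := by
      intro φ
      by_cases h : φ ∈ Ioc (0:ℝ) δ
      · rw [indicator_of_mem h, indicator_of_mem h, one_mul, ← Complex.exp_add]
        congr 1
        push_cast
        ring
      · rw [indicator_of_notMem h, indicator_of_notMem h, zero_mul]
    simp_rw [this]
    rw [integral_indicator measurableSet_Ioc, Measure.restrict_restrict measurableSet_Ioc,
      inter_eq_left.mpr]
    exact Ioc_subset_Ioc_right (by linarith)
  have hint : IntervalIntegrable (fun φ : ℝ =>
      Complex.exp (Complex.I * Complex.ofReal (x * (Real.cos φ - 1) + y * Real.sin φ)))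
      volume 0 δ := by
    apply Continuous.intervalIntegrable
    fun_prop
  have hre : δ / 2 ≤ ‖∫ φ in (0:ℝ)..δ,
        Complex.exp (Complex.I * Complex.ofReal (x * (Real.cos φ - 1) + y * Real.sin φ))‖ := by
    refine le_trans ?_ (Complex.re_le_norm _)
    have e : (∫ φ in (0:ℝ)..δ,
        Complex.exp (Complex.I * Complex.ofReal (x * (Real.cos φ - 1) + y * Real.sin φ))).re
        = ∫ φ in (0:ℝ)..δ, Real.cos (x * (Real.cos φ - 1) + y * Real.sin φ) := by
      have := Complex.reCLM.intervalIntegral_comp_comm hint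
      simp only [Complex.reCLM_apply] at this
      rw [← this]
      congr 1
      ext φ
      rw [mul_comm, Complex.exp_ofReal_mul_I_re]
    rw [e]
    have : ∫ φ in (0:ℝ)..δ, (1/2:ℝ) = δ / 2 := by simp; ring
    rw [← this]
    apply intervalIntegral.integral_mono_on h0.le (by simp)
    · apply Continuous.intervalIntegrable
      fun_prop
    · intro φ hφ
      obtain ⟨hφ0, hφ1⟩ := hφ
      have c1 : |Real.cos φ - 1| ≤ φ ^ 2 / 2 := by
        rw [abs_le]
        have := Real.one_sub_sq_div_two_le_cos (x := φ)
        have := Real.cos_le_one φ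
        constructor <;> nlinarith [sq_nonneg φ]
      have c2 : |Real.sin φ| ≤ φ := by
        simpa [abs_of_nonneg hφ0] using Real.abs_sin_le_abs (x := φ)
      have c3 : |x * (Real.cos φ - 1)| ≤ 1 / 2 := by
        rw [abs_mul]
        have : φ ^ 2 ≤ δ ^ 2 := by gcongr
        calc |x| * |Real.cos φ - 1| ≤ |x| * (δ ^ 2 / 2) := by gcongr; linarith
          _ ≤ 1 / 2 := by linarith
      have c4 : |y * Real.sin φ| ≤ 1 / 2 := by
        rw [abs_mul]
        calc |y| * |Real.sin φ| ≤ |y| * δ := by gcongr; linarith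
          _ ≤ 1 / 2 := by linarith
      have c5 : |x * (Real.cos φ - 1) + y * Real.sin φ| ≤ 1 :=
        (abs_add_le _ _).trans (by linarith)
      have c6 := (sq_le_one_iff_abs_le_one _).2 c5
      have := Real.one_sub_sq_div_two_le_cos (x := x * (Real.cos φ - 1) + y * Real.sin φ)
      linarith
  unfold Rext
  rw [key, norm_mul, norm_mul, mul_comm Complex.I, Complex.norm_exp_ofReal_mul_I, one_mul,
    Complex.norm_real, Real.norm_of_nonneg (by positivity)]
  calc δ / (4 * π) = 1 / (2 * π) * (δ / 2) := by field_simp; norm_num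
    _ ≤ _ := by gcongr

lemma knapp_sum (γ : ℝ) (hγ : 0 ≤ γ)
    (r : ℝ≥0∞) (hr : 1 ≤ r) (q : ℝ) (hq : 0 < q)
    (hbdd : ∃ C : ℝ, 0 < C ∧ ∀ F : ℝ → ℂ, Measurable F →
      planeLp (ENNReal.ofReal q) (fun p => Rgamma γ F p.1 p.2) ≤
        ENNReal.ofReal C * circleLp r F) :
    ∃ K : ℝ, 0 < K ∧ ∀ n : ℕ, ∀ S : Finset ℕ, ∀ m : ℕ → ℕ,
      (∀ k ∈ S, k + 1 ≤ 2 * n ∧ m k + 1 ≤ n ∧ m k ≤ k) →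
      ∑ k ∈ S, (2:ℝ) ^ (m k) * 2 ^ k * (4 * 2 ^ k) ^ (-(γ * q)) ≤
        K * (2:ℝ) ^ ((n:ℝ) * (q * (1 - r⁻¹.toReal))) := by
  obtain ⟨C, hC, hb⟩ := hbdd
  refine ⟨(C * (4 * π)) ^ q, by positivity, ?_⟩
  intro n S m hS
  set δ : ℝ := ((2:ℝ) ^ n)⁻¹ with hδ
  have h2n : (1:ℝ) ≤ 2 ^ n := one_le_pow₀ (by norm_num)
  have hδ0 : 0 < δ := by positivity
  have hδ1 : δ ≤ 1 := inv_le_one_of_one_le₀ h2n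
  have hpi := Real.pi_gt_three
  set F : ℝ → ℂ := (Ioc (0:ℝ) δ).indicator (fun _ => (1:ℂ)) with hF
  have hFm : Measurable F := measurable_const.indicator measurableSet_Ioc
  have h := hb F hFm
  have hnorm : circleLp r F = ENNReal.ofReal (δ ^ (r⁻¹.toReal)) := by
    unfold circleLp
    have hv : (volume.restrict (Ioc (0:ℝ) (2 * π))) (Ioc (0:ℝ) δ) = ENNReal.ofReal δ := by
      rw [Measure.restrict_apply measurableSet_Ioc, inter_eq_left.mpr
        (Ioc_subset_Ioc_right (by linarith)), Real.volume_Ioc, sub_zero]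
    rw [hF, eLpNorm_indicator_const' measurableSet_Ioc _ (by positivity), hv]
    · rw [ENNReal.toReal_inv, one_div, ENNReal.ofReal_rpow_of_pos hδ0]
      simp
    · rw [hv]; simpa using hδ0
  rw [hnorm, ← ENNReal.ofReal_mul hC.le] at h
  unfold planeLp at h
  rw [eLpNorm_eq_lintegral_rpow_enorm_toReal (by simpa using hq) (by simp),
    ENNReal.toReal_ofReal hq.le] at h
  have h' := ENNReal.rpow_le_rpow h hq.le
  rw [← ENNReal.rpow_mul, one_div, inv_mul_cancel₀ hq.ne', ENNReal.rpow_one,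
    ENNReal.ofReal_rpow_of_nonneg (by positivity) hq.le] at h'
  -- boxes
  let A : ℕ → Set (ℝ × ℝ) := fun k => Ico ((2:ℝ) ^ k) (2 ^ (k+1)) ×ˢ Ico (0:ℝ) (2 ^ (m k))
  have hAm : ∀ k, MeasurableSet (A k) := fun k => measurableSet_Ico.prod measurableSet_Ico
  have hAv : ∀ k, volume (A k) = ENNReal.ofReal ((2:ℝ) ^ (m k) * 2 ^ k) := by
    intro k
    simp only [A]
    rw [Measure.volume_eq_prod, Measure.prod_prod, Real.volume_Ico, Real.volume_Ico,
      ← ENNReal.ofReal_mul (by rw [pow_succ]; nlinarith [pow_pos (two_pos : (0:ℝ) < 2) k])]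
    congr 1
    ring
  have hdisj : Set.PairwiseDisjoint (S : Set ℕ) A := by
    have aux : ∀ i j, i < j → Disjoint (A i) (A j) := by
      intro i j hij
      refine Set.disjoint_left.2 fun p hp hp' => ?_
      have a1 := hp.1.2
      have a2 := hp'.1.1
      have : (2:ℝ) ^ (i+1) ≤ 2 ^ j := pow_le_pow_right₀ (by norm_num) hij
      linarith
    intro i _ j _ hij
    rcases lt_or_gt_of_ne hij with h | h
    · exact aux i j h
    · exact (aux j i h).symm
  have hpt : ∀ k ∈ S, ∀ p ∈ A k,
      ENNReal.ofReal ((δ / (4 * π)) ^ q * (4 * 2 ^ k) ^ (-(γ * q))) ≤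
        ‖Rgamma γ F p.1 p.2‖ₑ ^ q := by
    intro k hk p hp
    obtain ⟨⟨x1, x2⟩, ⟨y1, y2⟩⟩ := hp
    obtain ⟨s1, s2, s3⟩ := hS k hk
    have pk : (0:ℝ) < 2 ^ k := by positivity
    have x0 : 0 ≤ p.1 := pk.le.trans x1
    have b1 : p.1 ≤ (2 ^ n) ^ 2 := by
      rw [← pow_mul, mul_comm n]
      exact x2.le.trans (pow_le_pow_right₀ (by norm_num) s1)
    have b2 : 2 * p.2 ≤ 2 ^ n := by
      have : (2:ℝ) ^ (m k + 1) ≤ 2 ^ n := pow_le_pow_right₀ (by norm_num) s2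
      rw [pow_succ] at this
      linarith
    have b3 : p.2 ≤ 2 ^ k := y2.le.trans (pow_le_pow_right₀ (by norm_num) s3)
    have lo := knapp_lower δ hδ0 hδ1 p.1 p.2
      (by rw [abs_of_nonneg x0, hδ, inv_pow, ← div_eq_mul_inv, div_le_one (by positivity)]; exact b1)
      (by rw [abs_of_nonneg y1, hδ, ← div_eq_mul_inv, div_le_iff₀ (by positivity)]; linarith)
    have k1 : (1:ℝ) ≤ 2 ^ k := one_le_pow₀ (by norm_num)
    have w : (4 * 2 ^ k : ℝ) ^ (-γ) ≤ (1 + |p.1| + |p.2|) ^ (-γ) := by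
      rw [abs_of_nonneg x0, abs_of_nonneg y1]
      apply Real.rpow_le_rpow_of_nonpos (by linarith) _ (by linarith)
      rw [pow_succ] at x2
      linarith
    have hR : δ / (4 * π) * (4 * 2 ^ k : ℝ) ^ (-γ) ≤ ‖Rgamma γ F p.1 p.2‖ := by
      unfold Rgamma
      rw [norm_mul, Complex.norm_real, Real.norm_of_nonneg (by positivity)]
      exact mul_le_mul lo w (by positivity) (by positivity)
    rw [← ofReal_norm, ENNReal.ofReal_rpow_of_nonneg (norm_nonneg _) hq.le]
    apply ENNReal.ofReal_le_ofReal
    have := Real.rpow_le_rpow (by positivity) hR hq.le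
    rw [Real.mul_rpow (by positivity) (by positivity), ← Real.rpow_mul (by positivity)] at this
    rwa [neg_mul] at this
  have hsum : ENNReal.ofReal (∑ k ∈ S, ((δ / (4 * π)) ^ q * (4 * 2 ^ k) ^ (-(γ * q))) *
      ((2:ℝ) ^ (m k) * 2 ^ k)) ≤ ∫⁻ p : ℝ × ℝ, ‖Rgamma γ F p.1 p.2‖ₑ ^ q := by
    calc _ = ∑ k ∈ S, ENNReal.ofReal (((δ / (4 * π)) ^ q * (4 * 2 ^ k) ^ (-(γ * q))) *
          ((2:ℝ) ^ (m k) * 2 ^ k)) := ENNReal.ofReal_sum_of_nonneg (fun k _ => by positivity)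
      _ ≤ ∑ k ∈ S, ∫⁻ p in A k, ‖Rgamma γ F p.1 p.2‖ₑ ^ q := by
          apply Finset.sum_le_sum
          intro k hk
          rw [ENNReal.ofReal_mul (by positivity), ← hAv k, ← setLIntegral_const]
          exact setLIntegral_mono' (hAm k) (hpt k hk)
      _ = ∫⁻ p in ⋃ k ∈ S, A k, ‖Rgamma γ F p.1 p.2‖ₑ ^ q :=
          (lintegral_biUnion_finset hdisj (fun k _ => hAm k) _).symm
      _ ≤ _ := setLIntegral_le_lintegral _ _
  have fin := (ENNReal.ofReal_le_ofReal_iff (by positivity)).1 (hsum.trans h')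
  have e1 : ∑ k ∈ S, ((δ / (4 * π)) ^ q * (4 * 2 ^ k) ^ (-(γ * q))) * ((2:ℝ) ^ (m k) * 2 ^ k)
      = (δ / (4 * π)) ^ q * ∑ k ∈ S, (2:ℝ) ^ (m k) * 2 ^ k * (4 * 2 ^ k) ^ (-(γ * q)) := by
    rw [Finset.mul_sum]
    exact Finset.sum_congr rfl fun k _ => by ring
  rw [e1] at fin
  have hpos : 0 < (δ / (4 * π)) ^ q := by positivity
  refine le_of_mul_le_mul_left (fin.trans (le_of_eq ?_)) hpos
  have d1 : (2:ℝ) ^ ((n:ℝ) * (q * (1 - r⁻¹.toReal))) = δ ^ (-(1 - r⁻¹.toReal) * q) := by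
    rw [hδ, ← Real.rpow_natCast, ← Real.rpow_neg (by norm_num), ← Real.rpow_mul (by norm_num)]
    congr 1
    ring
  rw [d1, Real.mul_rpow hC.le (by positivity), Real.mul_rpow hC.le (by positivity),
    Real.div_rpow hδ0.le (by positivity), ← Real.rpow_mul hδ0.le]
  have d2 : δ ^ (r⁻¹.toReal * q) = δ ^ q * δ ^ (-(1 - r⁻¹.toReal) * q) := by
    rw [← Real.rpow_add hδ0]
    congr 1
    ring
  rw [d2]
  have : (4 * π) ^ q ≠ 0 := by positivity
  field_simp

lemma growth_unbdd (c K t : ℝ) (hc : 0 < c) (ht : 0 < t)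
    (h : ∀ n : ℕ, 1 ≤ n → c * (2:ℝ) ^ ((n:ℝ) * t) ≤ K) : False := by
  obtain ⟨n, hn⟩ := pow_unbounded_of_one_lt (K / c) (Real.one_lt_rpow (by norm_num : (1:ℝ) < 2) ht)
  have h1 := h (n + 1) (by omega)
  rw [div_lt_iff₀ hc] at hn
  have : ((2:ℝ) ^ t) ^ n ≤ (2:ℝ) ^ (((n + 1 : ℕ) : ℝ) * t) := by
    rw [← Real.rpow_natCast, ← Real.rpow_mul (by norm_num)]
    apply Real.rpow_le_rpow_of_exponent_le (by norm_num)
    push_cast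
    nlinarith
  nlinarith

lemma linear_unbdd (c K : ℝ) (hc : 0 < c) (h : ∀ n : ℕ, (n:ℝ) * c ≤ K) : False := by
  obtain ⟨n, hn⟩ := exists_nat_gt (K / c)
  rw [div_lt_iff₀ hc] at hn
  linarith [h n]

lemma four_pow (k : ℕ) (a : ℝ) : ((4:ℝ) * 2 ^ k) ^ a = (2:ℝ) ^ (((k:ℝ) + 2) * a) := by
  rw [Real.rpow_mul (by norm_num), Real.rpow_add (by norm_num), Real.rpow_natCast]
  norm_num
  rw [mul_comm]


/-- Lemma 20 (Knapp-type necessity) for `R*_γ`. -/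
theorem statement16 (γ : ℝ) (hγ : 0 ≤ γ)
    (r : ℝ≥0∞) (hr : 1 ≤ r) (q : ℝ) (hq : 0 < q)
    (hbdd : ∃ C : ℝ, 0 < C ∧ ∀ F : ℝ → ℂ, Measurable F →
      planeLp (ENNReal.ofReal q) (fun p => Rgamma γ F p.1 p.2) ≤
        ENNReal.ofReal C * circleLp r F) :
    (γ = 2 / q → 1 < r) ∧
    (1 / q < γ → γ < 2 / q → γ ≥ 2 / q - (1 - r⁻¹.toReal)) ∧
    (γ = 1 / q → 1 / q < 1 - r⁻¹.toReal) ∧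
    (γ < 1 / q → γ ≥ 3 / (2 * q) - (1 - r⁻¹.toReal) / 2) := by
  obtain ⟨K, hK, hmain⟩ := knapp_sum γ hγ r hr q hq hbdd
  set s : ℝ := 1 - r⁻¹.toReal with hs
  have two0 : (0:ℝ) < 2 := by norm_num
  refine ⟨?_, ?_, ?_, ?_⟩
  · intro hg
    by_contra hr1
    have hr1 : r = 1 := le_antisymm (not_lt.1 hr1) hr
    have hs0 : s = 0 := by rw [hs, hr1]; simp
    have hgq : γ * q = 2 := by rw [hg]; field_simp
    apply linear_unbdd (1 / 16) K (by norm_num)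
    intro n
    have := hmain n (Finset.range n) (fun k => k) (by
      intro k hk
      have := Finset.mem_range.1 hk
      refine ⟨?_, ?_, ?_⟩ <;> omega)
    rw [hs0, hgq] at this
    simp only [mul_zero, Real.rpow_zero, mul_one] at this
    refine le_trans (le_of_eq ?_) this
    have e : ∀ k ∈ Finset.range n, (2:ℝ) ^ k * 2 ^ k * (4 * 2 ^ k) ^ (-2 : ℝ) = 1 / 16 := by
      intro k _
      rw [Real.rpow_neg (by positivity), Real.rpow_ofNat]
      field_simp
      norm_num
    rw [Finset.sum_congr rfl e]
    simp
  · intro _ _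
    by_contra hcon
    have hcon : γ < 2 / q - s := not_le.1 hcon
    have ht : 0 < 2 - γ * q - q * s := by
      have := mul_lt_mul_of_pos_right hcon hq
      have e : (2 / q - s) * q = 2 - q * s := by field_simp
      linarith
    apply growth_unbdd ((2:ℝ) ^ (-2 - γ * q)) K _ (by positivity) ht
    intro n hn
    obtain ⟨j, rfl⟩ : ∃ j, n = j + 1 := ⟨n - 1, by omega⟩
    have := hmain (j + 1) {j} (fun k => k) (by
      intro k hk
      have := Finset.mem_singleton.1 hk
      refine ⟨?_, ?_, ?_⟩ <;> omega)
    rw [Finset.sum_singleton, four_pow, ← Real.rpow_natCast, ← Real.rpow_add two0,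
      ← Real.rpow_add two0, ← div_le_iff₀ (by positivity), ← Real.rpow_sub two0] at this
    rw [← Real.rpow_add two0]
    refine le_trans (le_of_eq ?_) this
    congr 1
    push_cast
    ring
  · intro hg
    by_contra hcon
    have hcon : s ≤ 1 / q := not_lt.1 hcon
    have hgq : γ * q = 1 := by rw [hg]; field_simp
    have hqs : q * s ≤ 1 := by
      have := mul_le_mul_of_nonneg_left hcon hq.le
      rwa [mul_one_div_cancel hq.ne'] at this
    apply linear_unbdd (1 / 8) K (by norm_num)
    intro n
    rcases Nat.eq_zero_or_pos n with rfl | hn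
    · simpa using hK.le
    obtain ⟨j, rfl⟩ : ∃ j, n = j + 1 := ⟨n - 1, by omega⟩
    have := hmain (j + 1) (Finset.Ico (j + 1) (2 * (j + 1))) (fun _ => j) (by
      intro k hk
      have := Finset.mem_Ico.1 hk
      refine ⟨?_, ?_, ?_⟩ <;> omega)
    rw [hgq] at this
    have e : ∀ k ∈ Finset.Ico (j + 1) (2 * (j + 1)),
        (2:ℝ) ^ j * 2 ^ k * (4 * 2 ^ k) ^ (-1 : ℝ) = 1 / 8 * 2 ^ (j + 1) := by
      intro k _
      rw [Real.rpow_neg_one, pow_succ]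
      field_simp
      norm_num
    rw [Finset.sum_congr rfl e, Finset.sum_const, Nat.card_Ico, nsmul_eq_mul,
      show 2 * (j + 1) - (j + 1) = j + 1 by omega] at this
    have u : (2:ℝ) ^ (((j + 1 : ℕ) : ℝ) * (q * s)) ≤ 2 ^ (j + 1) := by
      rw [← Real.rpow_natCast]
      apply Real.rpow_le_rpow_of_exponent_le (by norm_num)
      exact mul_le_of_le_one_right (by positivity) hqs
    have p0 : (0:ℝ) < 2 ^ (j + 1) := by positivity
    refine le_of_mul_le_mul_right ?_ p0
    calc _ = _ := mul_assoc _ _ _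
      _ ≤ _ := this
      _ ≤ _ := by gcongr
  · intro _
    by_contra hcon
    have hcon : γ < 3 / (2 * q) - s / 2 := not_le.1 hcon
    have ht : 0 < 3 - 2 * (γ * q) - q * s := by
      have := mul_lt_mul_of_pos_right hcon hq
      have e : (3 / (2 * q) - s / 2) * q = (3 - q * s) / 2 := by field_simp
      linarith
    apply growth_unbdd ((2:ℝ) ^ (-2 - γ * q)) K _ (by positivity) ht
    intro n hn
    obtain ⟨j, rfl⟩ : ∃ j, n = j + 1 := ⟨n - 1, by omega⟩
    have := hmain (j + 1) {2 * j + 1} (fun k => j) (by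
      intro k hk
      have := Finset.mem_singleton.1 hk
      refine ⟨?_, ?_, ?_⟩ <;> omega)
    rw [Finset.sum_singleton, four_pow, ← Real.rpow_natCast, ← Real.rpow_natCast,
      ← Real.rpow_add two0,
      ← Real.rpow_add two0, ← div_le_iff₀ (by positivity), ← Real.rpow_sub two0] at this
    rw [← Real.rpow_add two0]
    refine le_trans (le_of_eq ?_) this
    congr 1
    push_cast
    ring
end
end
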